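/- arXiv:1108.1550 — 13 statements merged into one kernel-verified Lean document; each statement's English description precedes it below -/
import Mathlib

section
/- The limit as x tends to 0 (through nonzero real values) of (Γ(1/2 − x)/Γ(1/2))^(1/x) equals 4·e^γ, i.e. the function x ↦ (Γ(1/2 − x)/Γ(1/2))^(1/x) tends to 4·exp(γ) along the punctured neighborhood filter at 0. -/
open Real Filter

/-- The limit as `x → 0` (through nonzero reals) of
`(Γ(1/2 − x)/Γ(1/2))^(1/x)` equals `4·e^γ`. -/
theorem gamma_half_limit :
    Tendsto (fun x : ℝ => (Real.Gamma (1 / 2 - x) / Real.Gamma (1 / 2)) ^ (1 / x))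
      (nhdsWithin 0 {0}ᶜ) (nhds (4 * Real.exp Real.eulerMascheroniConstant)) := by
  have hpi : √π ≠ 0 := (Real.sqrt_pos.mpr Real.pi_pos).ne'
  have hG : Real.Gamma (1 / 2) ≠ 0 := (Real.Gamma_pos_of_pos (by norm_num)).ne'
  have h1 : HasDerivAt (fun x : ℝ => 1 / 2 - x) (-1) 0 := by
    exact (hasDerivAt_id (0 : ℝ)).const_sub (1 / 2)
  have h0 : HasDerivAt Real.Gamma
      (-√π * (Real.eulerMascheroniConstant + 2 * Real.log 2)) (1 / 2 - 0) := by
    rw [sub_zero]; exact Real.hasDerivAt_Gamma_one_half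
  have h2 := (HasDerivAt.comp (0 : ℝ) h0 h1).div_const (Real.Gamma (1 / 2))
  have h3 := h2.log (by simp only [Function.comp, sub_zero]; rw [div_self hG]; exact one_ne_zero)
  have h4 := hasDerivAt_iff_tendsto_slope.mp h3
  have h5 := (Real.continuous_exp.tendsto _).comp h4
  have hv : 4 * Real.exp Real.eulerMascheroniConstant =
      Real.exp (Real.eulerMascheroniConstant + 2 * Real.log 2) := by
    rw [Real.exp_add, two_mul, Real.exp_add, Real.exp_log two_pos]; ring
  rw [hv]
  refine Tendsto.congr' ?_ (h5.trans (le_of_eq ?_))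
  · have hlt : ∀ᶠ x : ℝ in nhdsWithin 0 {0}ᶜ, x < 1 / 2 :=
      (eventually_lt_nhds (by norm_num)).filter_mono nhdsWithin_le_nhds
    filter_upwards [hlt] with x hx
    have hp : 0 < Real.Gamma (1 / 2 - x) / Real.Gamma (1 / 2) :=
      div_pos (Real.Gamma_pos_of_pos (by linarith)) (Real.Gamma_pos_of_pos (by norm_num))
    rw [Real.rpow_def_of_pos hp]
    simp only [Function.comp, slope_def_field, sub_zero]
    rw [div_self hG, Real.log_one, sub_zero, mul_one_div]
  · congr 2
    simp only [Function.comp, sub_zero]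
    rw [div_self hG, Real.Gamma_one_half_eq]
    field_simp
end

section
/- The limit as x tends to 0 (through nonzero real values) of (Γ(3/2 − x)/Γ(3/2))^(1/x) equals 4·e^(γ−2), i.e. the function x ↦ (Γ(3/2 − x)/Γ(3/2))^(1/x) tends to 4·exp(γ−2) along the punctured neighborhood filter at 0. -/
open Real Filter

/-- The limit as `x → 0` (through nonzero reals) of
`(Γ(3/2 − x)/Γ(3/2))^(1/x)` equals `4·e^(γ−2)`. -/
theorem gamma_three_half_limit :
    Tendsto (fun x : ℝ => (Real.Gamma (3 / 2 - x) / Real.Gamma (3 / 2)) ^ (1 / x))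
      (nhdsWithin 0 {0}ᶜ)
      (nhds (4 * Real.exp (Real.eulerMascheroniConstant - 2))) := by
  have hpi : √π ≠ 0 := (Real.sqrt_pos.mpr Real.pi_pos).ne'
  have h32 : Real.Gamma (3 / 2) = √π / 2 := by
    rw [show (3 / 2 : ℝ) = 1 / 2 + 1 by norm_num, Real.Gamma_add_one (by norm_num),
      Real.Gamma_one_half_eq]
    ring
  have hlt : ∀ᶠ x : ℝ in nhds 0, x < 1 / 2 := eventually_lt_nhds (by norm_num)
  have hs : HasDerivAt (fun x : ℝ => 1 / 2 - x) (-1) 0 := by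
    exact (hasDerivAt_id (0 : ℝ)).const_sub (1 / 2)
  have hG : HasDerivAt (fun x : ℝ => Real.Gamma (1 / 2 - x))
      (-√π * (Real.eulerMascheroniConstant + 2 * Real.log 2) * (-1)) 0 := by
    have h := Real.hasDerivAt_Gamma_one_half
    rw [show (1 / 2 : ℝ) = 1 / 2 - 0 by norm_num] at h
    exact HasDerivAt.comp (h₂ := Real.Gamma) (h := fun x : ℝ => 1 / 2 - x) 0 h hs
  have hF : HasDerivAt (fun x : ℝ => Real.Gamma (3 / 2 - x) / Real.Gamma (3 / 2))
      (Real.eulerMascheroniConstant + 2 * Real.log 2 - 2) 0 := by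
    have h := (hs.mul hG).div_const (√π / 2)
    refine (h.congr_of_eventuallyEq ?_).congr_deriv ?_
    · filter_upwards [hlt] with x hx
      rw [h32, show (3 / 2 - x : ℝ) = (1 / 2 - x) + 1 by ring, Real.Gamma_add_one (by linarith)]
      rfl
    · rw [sub_zero, Real.Gamma_one_half_eq]
      field_simp
      ring
  have h1 : Real.Gamma (3 / 2 - 0) / Real.Gamma (3 / 2) = 1 := by
    rw [sub_zero, h32]
    field_simp
  have hL := hF.log (by rw [h1]; exact one_ne_zero)
  rw [hasDerivAt_iff_tendsto_slope] at hL
  have hE := (Real.continuous_exp.tendsto _).comp hL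
  have hv : Real.exp ((Real.eulerMascheroniConstant + 2 * Real.log 2 - 2) /
      (Real.Gamma (3 / 2 - 0) / Real.Gamma (3 / 2)))
      = 4 * Real.exp (Real.eulerMascheroniConstant - 2) := by
    rw [h1, div_one, show Real.eulerMascheroniConstant + 2 * Real.log 2 - 2
      = Real.log 2 + Real.log 2 + (Real.eulerMascheroniConstant - 2) by ring, Real.exp_add,
      Real.exp_add, Real.exp_log two_pos]
    norm_num
  rw [hv] at hE
  refine hE.congr' ?_
  filter_upwards [hlt.filter_mono nhdsWithin_le_nhds] with x hx
  have hp : 0 < Real.Gamma (3 / 2 - x) / Real.Gamma (3 / 2) :=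
    div_pos (Real.Gamma_pos_of_pos (by linarith)) (Real.Gamma_pos_of_pos (by norm_num))
  rw [Function.comp_apply, Real.rpow_def_of_pos hp, slope_def_field, h1, Real.log_one]
  congr 1
  simp [div_eq_mul_inv]
end

section
/- The sequence m ↦ 2^(m/4) · (Γ((3m+2)/(2m+4))/√π)^((m+2)/4) (m ranging over the positive integers) converges to √2 · e^(γ/2 − 1) as m → ∞. (Here (3m+2)/(2m+4) = ((2m/(m+2)) + 1)/2.) -/
open Real Filter

lemma aux_hasDeriv : HasDerivAt (fun y : ℝ => Real.log (Real.Gamma y))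
    (2 - Real.eulerMascheroniConstant - 2 * Real.log 2) (3 / 2) := by
  have hpi : 0 < Real.sqrt π := Real.sqrt_pos.2 Real.pi_pos
  have h1 : HasDerivAt (fun y : ℝ => Real.Gamma (y - 1))
      (-√π * (Real.eulerMascheroniConstant + 2 * Real.log 2)) (3 / 2) := by
    have h := Real.hasDerivAt_Gamma_one_half
    have e : (1 / 2 : ℝ) = 3 / 2 - 1 := by norm_num
    rw [e] at h
    exact h.comp_sub_const (3 / 2) 1
  have h2 : HasDerivAt (fun y : ℝ => (y - 1) * Real.Gamma (y - 1))
      (1 * Real.Gamma (3 / 2 - 1) + (3 / 2 - 1) *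
        (-√π * (Real.eulerMascheroniConstant + 2 * Real.log 2))) (3 / 2) :=
    ((hasDerivAt_id (3 / 2 : ℝ)).sub_const 1).mul h1
  have h3 : HasDerivAt (fun y : ℝ => Real.Gamma y)
      (1 * Real.Gamma (3 / 2 - 1) + (3 / 2 - 1) *
        (-√π * (Real.eulerMascheroniConstant + 2 * Real.log 2))) (3 / 2) := by
    refine h2.congr_of_eventuallyEq ?_
    filter_upwards [lt_mem_nhds (show (1 : ℝ) < 3 / 2 by norm_num)] with y hy
    rw [← Real.Gamma_add_one (by linarith)]
    ring_nf
  have e1 : Real.Gamma (3 / 2 - 1) = √π := by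
    rw [← Real.Gamma_one_half_eq]; norm_num
  have e2 : Real.Gamma (3 / 2) = √π / 2 := by
    have := Real.Gamma_add_one (s := 1 / 2) (by norm_num)
    rw [Real.Gamma_one_half_eq] at this
    rw [show (3 / 2 : ℝ) = 1 / 2 + 1 by norm_num, this]; ring
  have h4 := h3.log (by rw [e2]; positivity)
  rw [e1, e2] at h4
  convert h4 using 1
  field_simp
  ring

/-- The sequence `m ↦ 2^(m/4) · (Γ((3m+2)/(2m+4))/√π)^((m+2)/4)` converges to
`√2 · e^(γ/2 − 1)`. -/
theorem gamma_seq_limit' :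
    Tendsto
      (fun m : ℕ =>
        (2 : ℝ) ^ ((m : ℝ) / 4) *
          (Real.Gamma ((3 * (m : ℝ) + 2) / (2 * (m : ℝ) + 4)) / Real.sqrt π) ^
            (((m : ℝ) + 2) / 4))
      atTop (nhds (Real.sqrt 2 * Real.exp (Real.eulerMascheroniConstant / 2 - 1))) := by
  have hpi : 0 < Real.sqrt π := Real.sqrt_pos.2 Real.pi_pos
  have e2 : Real.Gamma (3 / 2) = √π / 2 := by
    have := Real.Gamma_add_one (s := 1 / 2) (by norm_num)
    rw [Real.Gamma_one_half_eq] at this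
    rw [show (3 / 2 : ℝ) = 1 / 2 + 1 by norm_num, this]; ring
  have hs := hasDerivAt_iff_tendsto_slope_zero.1 aux_hasDeriv
  have ht : Tendsto (fun m : ℕ => -(2 / ((m : ℝ) + 2))) atTop (nhdsWithin 0 {0}ᶜ) := by
    refine tendsto_nhdsWithin_iff.2 ⟨?_, Eventually.of_forall fun m => ?_⟩
    · have : Tendsto (fun m : ℕ => (m : ℝ) + 2) atTop atTop :=
        tendsto_atTop_add_const_right _ _ tendsto_natCast_atTop_atTop
      simpa using (this.const_div_atTop 2).neg
    · have : (0 : ℝ) < 2 / ((m : ℝ) + 2) := by positivity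
      simp only [Set.mem_compl_iff, Set.mem_singleton_iff]
      linarith
  have hl := (((hs.comp ht).const_mul (-1 / 2)).add_const (-Real.log 2 / 2)).rexp
  have hlim : Real.sqrt 2 * Real.exp (Real.eulerMascheroniConstant / 2 - 1) =
      Real.exp (-1 / 2 * (2 - Real.eulerMascheroniConstant - 2 * Real.log 2)
        + -Real.log 2 / 2) := by
    rw [Real.sqrt_eq_rpow, Real.rpow_def_of_pos (by norm_num), ← Real.exp_add]
    congr 1; ring
  rw [hlim]
  refine hl.congr fun m => ?_
  have hm : (0 : ℝ) < (m : ℝ) + 2 := by positivity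
  have hx : (3 / 2 : ℝ) + -(2 / ((m : ℝ) + 2)) = (3 * (m : ℝ) + 2) / (2 * (m : ℝ) + 4) := by
    have : (2 * (m : ℝ) + 4) ≠ 0 := by positivity
    field_simp
    ring
  have hG : 0 < Real.Gamma ((3 * (m : ℝ) + 2) / (2 * (m : ℝ) + 4)) :=
    Real.Gamma_pos_of_pos (by positivity)
  simp only [Function.comp, smul_eq_mul]
  rw [hx, e2, Real.rpow_def_of_pos (by norm_num), Real.rpow_def_of_pos (by positivity),
    ← Real.exp_add, Real.log_div hG.ne' hpi.ne', Real.log_div hpi.ne' (by norm_num)]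
  congr 1
  field_simp
  ring
end

section
/- The sequence m ↦ (A_{2m/(m+2)}^(m/2))^(−1) (m ranging over the positive integers) converges to e^(1 − γ/2)/√2 as m → ∞. -/
open Real Filter

/-- The Khinchine-inequality constant `A_p = √2 · (Γ((p+1)/2)/√π)^(1/p)`. -/
noncomputable def khinchineA (p : ℝ) : ℝ :=
  Real.sqrt 2 * (Real.Gamma ((p + 1) / 2) / Real.sqrt π) ^ (1 / p)

theorem aux_deriv : HasDerivAt (fun x : ℝ => Real.log x + Real.log (Real.Gamma x))
    (2 - (Real.eulerMascheroniConstant + 2 * Real.log 2)) (1 / 2) := by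
  have hp : (0:ℝ) < Real.sqrt π := Real.sqrt_pos.mpr Real.pi_pos
  have h1 := Real.hasDerivAt_log (x := 1 / 2) (by norm_num)
  have h2 := Real.hasDerivAt_Gamma_one_half.log (by rw [Real.Gamma_one_half_eq]; exact hp.ne')
  refine (h1.add h2).congr_deriv ?_
  rw [Real.Gamma_one_half_eq]
  field_simp
  ring

theorem aux_lim : Tendsto (fun m : ℕ => -(-(2 / ((m : ℝ) + 2)))⁻¹ / 2 *
      ((Real.log (1 / 2 + -(2 / ((m : ℝ) + 2))) +
        Real.log (Real.Gamma (1 / 2 + -(2 / ((m : ℝ) + 2))))) -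
        (Real.log (1 / 2) + Real.log (Real.Gamma (1 / 2)))))
      atTop (nhds (-(2 - (Real.eulerMascheroniConstant + 2 * Real.log 2)) / 2)) := by
  have h := hasDerivAt_iff_tendsto_slope_zero.mp aux_deriv
  have hm : Tendsto (fun m : ℕ => -(2 / ((m : ℝ) + 2))) atTop (nhdsWithin 0 {0}ᶜ) := by
    refine tendsto_nhdsWithin_iff.mpr ⟨?_, ?_⟩
    · have h3 : Tendsto (fun m : ℕ => (m : ℝ) + 2) atTop atTop :=
        tendsto_atTop_add_const_right _ _ tendsto_natCast_atTop_atTop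
      simpa using (h3.const_div_atTop 2).neg
    · refine Eventually.of_forall fun m => ?_
      have : (0:ℝ) < 2 / ((m : ℝ) + 2) := by positivity
      simp only [Set.mem_compl_iff, Set.mem_singleton_iff]
      linarith
  have h4 := ((h.comp hm).neg).div_const 2
  refine h4.congr fun m => ?_
  simp only [Function.comp, smul_eq_mul]
  ring

/-- The sequence `m ↦ (A_{2m/(m+2)}^(m/2))⁻¹` converges to `e^(1 − γ/2)/√2`. -/
theorem khinchineA_seq_limit :
    Tendsto
      (fun m : ℕ => (khinchineA (2 * (m : ℝ) / ((m : ℝ) + 2)) ^ ((m : ℝ) / 2))⁻¹)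
      atTop (nhds (Real.exp (1 - Real.eulerMascheroniConstant / 2) / Real.sqrt 2)) := by
  have hp : (0:ℝ) < Real.sqrt π := Real.sqrt_pos.mpr Real.pi_pos
  have hs : (0:ℝ) < Real.sqrt 2 := by positivity
  have h := Real.continuous_exp.continuousAt.tendsto.comp
    ((aux_lim.sub_const (Real.log 2 / 2)).neg)
  have h2 : Real.exp (1 - Real.eulerMascheroniConstant / 2) / Real.sqrt 2 =
      Real.exp (-(-(2 - (Real.eulerMascheroniConstant + 2 * Real.log 2)) / 2
        - (Real.log 2 / 2)))  := by
    rw [← Real.exp_log hs, ← Real.exp_sub, Real.log_sqrt (by norm_num)]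
    congr 1
    ring
  rw [h2]
  refine h.congr' ?_
  filter_upwards [eventually_ge_atTop 3] with m hm
  have hm' : (3:ℝ) ≤ m := by exact_mod_cast hm
  have hx : (0:ℝ) < 1 / 2 + -(2 / ((m : ℝ) + 2)) := by
    have : 2 / ((m : ℝ) + 2) < 1 / 2 := by
      rw [div_lt_div_iff₀ (by linarith) (by norm_num)]; linarith
    linarith
  have he : (2 * (m : ℝ) / ((m : ℝ) + 2) + 1) / 2 = (1 / 2 + -(2 / ((m : ℝ) + 2))) + 1 := by
    field_simp
    ring
  have hi : (-(2 / ((m : ℝ) + 2)))⁻¹ = -(((m : ℝ) + 2) / 2) := by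
    rw [inv_neg, inv_div]
  have hq : 1 / (2 * (m : ℝ) / ((m : ℝ) + 2)) = ((m : ℝ) + 2) / (2 * m) := by
    rw [one_div_div]
  simp only [Function.comp, khinchineA]
  rw [he, Real.Gamma_add_one hx.ne', hi, hq, Real.Gamma_one_half_eq]
  set x := 1 / 2 + -(2 / ((m : ℝ) + 2)) with hxd
  have hG := Real.Gamma_pos_of_pos hx
  have hb : 0 < x * Real.Gamma x / Real.sqrt π := by positivity
  have hl : Real.log (1 / 2) = - Real.log 2 := by rw [one_div, Real.log_inv]
  have hm0 : (m:ℝ) ≠ 0 := by linarith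
  rw [Real.rpow_def_of_pos (by positivity), ← Real.exp_neg,
    Real.log_mul hs.ne' (Real.rpow_pos_of_pos hb _).ne', Real.log_rpow hb,
    Real.log_div (by positivity) hp.ne', Real.log_mul hx.ne' hG.ne', hl,
    Real.log_sqrt (x := 2) (by norm_num)]
  congr 1
  clear_value x
  field_simp
  ring
end

section
/- The sequence m ↦ (A_{(2m−2)/(m+1)}^((m+1)/2))^(−(m−1)/(2m)) (m ranging over the integers m ≥ 2) converges to e^(1/2 − γ/4)/2^(1/4) as m → ∞. -/
open Real Filter

lemma gammaLogDeriv : HasDerivAt (fun x : ℝ => Real.log (Real.Gamma x))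
    (2 - Real.eulerMascheroniConstant - 2 * Real.log 2) (3/2) := by
  have h1 : HasDerivAt Real.Gamma (-√π * (Real.eulerMascheroniConstant + 2 * Real.log 2)) (3/2 - 1) := by
    have := Real.hasDerivAt_Gamma_one_half
    norm_num at this ⊢
    exact this
  have h2 : HasDerivAt (fun x : ℝ => Real.Gamma (x - 1))
      (-√π * (Real.eulerMascheroniConstant + 2 * Real.log 2)) (3/2) := h1.comp_sub_const (3/2) 1
  have hs : 0 < √π := by positivity
  have hg : Real.Gamma (3/2 - 1) = √π := by
    rw [← Real.Gamma_one_half_eq]; norm_num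
  have h3 := (((hasDerivAt_id (3/2 : ℝ)).sub_const 1).log (by norm_num)).add
    (h2.log (by rw [hg]; exact hs.ne'))
  have h4 : HasDerivAt (fun x : ℝ => Real.log (x - 1) + Real.log (Real.Gamma (x - 1)))
    (2 - Real.eulerMascheroniConstant - 2 * Real.log 2) (3/2) := by
    refine h3.congr_deriv ?_
    rw [hg]
    simp only [id]
    field_simp
    ring
  refine h4.congr_of_eventuallyEq ?_
  filter_upwards [lt_mem_nhds (show (1:ℝ) < 3/2 by norm_num)] with x hx
  have hx0 : 0 < x - 1 := by linarith
  have := Real.Gamma_add_one hx0.ne'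
  rw [sub_add_cancel] at this
  rw [this, Real.log_mul hx0.ne' (Real.Gamma_pos_of_pos hx0).ne']

theorem khinchineA_seq_limit_odd_left :
    Tendsto
      (fun m : ℕ =>
        (khinchineA ((2 * (m : ℝ) - 2) / ((m : ℝ) + 1)) ^ (((m : ℝ) + 1) / 2)) ^
          (-(((m : ℝ) - 1) / (2 * (m : ℝ)))))
      atTop
      (nhds (Real.exp (1 / 2 - Real.eulerMascheroniConstant / 4) / (2 : ℝ) ^ ((1 : ℝ) / 4))) := by
  set D := 2 - Real.eulerMascheroniConstant - 2 * Real.log 2 with hD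
  set S : ℝ → ℝ := fun t => t⁻¹ * (Real.log (Real.Gamma (3/2 + t)) - Real.log (Real.Gamma (3/2)))
    with hS
  have hi : Tendsto (fun m : ℕ => ((m:ℝ))⁻¹) atTop (nhds 0) := tendsto_inv_atTop_nhds_zero_nat
  have hi1 : Tendsto (fun m : ℕ => ((m:ℝ)+1)⁻¹) atTop (nhds 0) := by
    simpa using tendsto_one_div_add_atTop_nhds_zero_nat (𝕜 := ℝ)
  have ht0 : Tendsto (fun m : ℕ => -2 * ((m:ℝ)+1)⁻¹) atTop (nhds 0) := by
    simpa using hi1.const_mul (-2)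
  have ht : Tendsto (fun m : ℕ => -2 * ((m:ℝ)+1)⁻¹) atTop (nhdsWithin 0 {0}ᶜ) := by
    refine tendsto_nhdsWithin_iff.2 ⟨ht0, Eventually.of_forall fun m => ?_⟩
    have : 0 < ((m:ℝ)+1)⁻¹ := by positivity
    simp only [Set.mem_compl_iff, Set.mem_singleton_iff]
    linarith
  have hSl : Tendsto (fun m : ℕ => S (-2 * ((m:ℝ)+1)⁻¹)) atTop (nhds D) := by
    have := gammaLogDeriv.tendsto_slope_zero.comp ht
    simp only [smul_eq_mul] at this
    exact this
  have hone : Tendsto (fun m : ℕ => 1 + ((m:ℝ))⁻¹) atTop (nhds 1) := by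
    simpa using hi.const_add 1
  have hmain : Tendsto (fun m : ℕ => Real.exp ((1 + (m:ℝ)⁻¹) *
      (Real.log 2 / 4 + S (-2 * ((m:ℝ)+1)⁻¹) / 4))) atTop
      (nhds (Real.exp (1 * (Real.log 2 / 4 + D / 4)))) :=
    (Real.continuous_exp.tendsto _).comp (hone.mul ((hSl.div_const 4).const_add _))
  have hlim : Real.exp (1 / 2 - Real.eulerMascheroniConstant / 4) / (2 : ℝ) ^ ((1 : ℝ) / 4)
      = Real.exp (1 * (Real.log 2 / 4 + D / 4)) := by
    rw [Real.rpow_def_of_pos (by norm_num), ← Real.exp_sub, hD]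
    congr 1
    ring
  rw [hlim]
  refine hmain.congr' ?_
  filter_upwards [eventually_ge_atTop 2] with m hm
  have hm' : (2:ℝ) ≤ m := by exact_mod_cast hm
  have hp : (0:ℝ) < m + 1 := by linarith
  have hm1 : (0:ℝ) < m - 1 := by linarith
  have hm0 : (0:ℝ) < m := by linarith
  have harg : ((2 * (m : ℝ) - 2) / ((m : ℝ) + 1) + 1) / 2 = 3/2 + -2 * ((m:ℝ)+1)⁻¹ := by
    field_simp; ring
  have hargpos : 0 < 3/2 + -2 * ((m:ℝ)+1)⁻¹ := by
    rw [← harg]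
    have : 0 < 2 * (m:ℝ) - 2 := by linarith
    positivity
  have hG := Real.Gamma_pos_of_pos hargpos
  have hs : 0 < √π := by positivity
  have hR : 0 < Real.Gamma (3/2 + -2 * ((m:ℝ)+1)⁻¹) / √π := by positivity
  have hg32 : Real.log (Real.Gamma (3/2)) = Real.log √π - Real.log 2 := by
    have := Real.Gamma_add_one (s := 1/2) (by norm_num)
    rw [Real.Gamma_one_half_eq] at this
    rw [show (3/2:ℝ) = 1/2 + 1 by norm_num, this, Real.log_mul (by norm_num) hs.ne']
    simp
    ring
  have hApos : 0 < khinchineA ((2 * (m : ℝ) - 2) / ((m : ℝ) + 1)) := by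
    unfold khinchineA; rw [harg]; positivity
  have hlogA : Real.log (khinchineA ((2 * (m : ℝ) - 2) / ((m : ℝ) + 1)))
      = Real.log 2 / 2 + (m+1) / (2*(m-1)) *
        (-Real.log 2 + -2 * ((m:ℝ)+1)⁻¹ * S (-2 * ((m:ℝ)+1)⁻¹)) := by
    unfold khinchineA; rw [harg]
    rw [Real.log_mul (by positivity) (by positivity), Real.log_sqrt (by norm_num),
      Real.log_rpow hR, Real.log_div hG.ne' hs.ne', hS]
    have e : (1 / ((2 * (m : ℝ) - 2) / ((m : ℝ) + 1))) = (m+1) / (2*(m-1)) := by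
      rw [one_div_div]; ring
    have e2 : -2 * ((m:ℝ)+1)⁻¹ ≠ 0 := by
      have : 0 < ((m:ℝ)+1)⁻¹ := by positivity
      linarith
    simp only []
    rw [e, mul_inv_cancel_left₀ e2, hg32]
    ring
  rw [← Real.rpow_mul hApos.le, Real.rpow_def_of_pos hApos, hlogA]
  congr 1
  generalize S _ = s
  field_simp
  ring
end

section
/- The sequence m ↦ (A_{(2m+2)/(m+3)}^((m−1)/2))^(−(m+1)/(2m)) (m ranging over the positive integers) converges to e^(1/2 − γ/4)/2^(1/4) as m → ∞. -/
open Real Filter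

lemma kA_gamma_deriv : HasDerivAt (fun p : ℝ => Real.Gamma ((p + 1) / 2))
    (Real.sqrt π / 4 * (2 - Real.eulerMascheroniConstant - 2 * Real.log 2)) 2 := by
  have h1 : HasDerivAt (fun p : ℝ => (p - 1) / 2) (1 / 2) 2 :=
    ((hasDerivAt_id (2 : ℝ)).sub_const 1).div_const 2
  have h0 : HasDerivAt Real.Gamma
      (-√π * (Real.eulerMascheroniConstant + 2 * Real.log 2)) (((2 : ℝ) - 1) / 2) := by
    have := Real.hasDerivAt_Gamma_one_half
    rwa [show ((2 : ℝ) - 1) / 2 = 1 / 2 by norm_num]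
  have h2 := HasDerivAt.comp (h := fun p : ℝ => (p - 1) / 2) (2 : ℝ) h0 h1
  have h3 := h1.mul h2
  have h4 : (fun p : ℝ => Real.Gamma ((p + 1) / 2)) =ᶠ[nhds 2]
      ((fun p : ℝ => (p - 1) / 2) * (Real.Gamma ∘ fun p : ℝ => (p - 1) / 2)) := by
    filter_upwards [lt_mem_nhds (show (1 : ℝ) < 2 by norm_num)] with p hp
    have : (p - 1) / 2 ≠ 0 := by
      have : 0 < p - 1 := by linarith
      positivity
    simp only [Pi.mul_apply, Function.comp]
    rw [← Real.Gamma_add_one this]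
    congr 1; ring
  refine (h3.congr_of_eventuallyEq h4).congr_deriv ?_
  simp only [Function.comp]
  rw [show ((2 : ℝ) - 1) / 2 = 1 / 2 by norm_num, Real.Gamma_one_half_eq]
  ring

lemma kA_gamma_val : Real.Gamma (((2 : ℝ) + 1) / 2) = √π / 2 := by
  rw [show ((2 : ℝ) + 1) / 2 = 1 / 2 + 1 by norm_num, Real.Gamma_add_one (by norm_num),
    Real.Gamma_one_half_eq]
  ring

lemma kA_pos {p : ℝ} (hp : 0 < p) : 0 < khinchineA p := by
  unfold khinchineA
  have : 0 < Real.Gamma ((p + 1) / 2) := Real.Gamma_pos_of_pos (by positivity)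
  positivity

lemma kA_two : Real.log (khinchineA 2) = 0 := by
  have hs : 0 < √π := by positivity
  unfold khinchineA
  rw [kA_gamma_val, Real.log_mul (by positivity) (by positivity), Real.log_rpow (by positivity),
    Real.log_sqrt (by norm_num), show √π / 2 / √π = 2⁻¹ by field_simp, Real.log_inv]
  ring

lemma kA_log_deriv : HasDerivAt (fun p : ℝ => Real.log (khinchineA p))
    (1 / 2 - Real.eulerMascheroniConstant / 4 - Real.log 2 / 4) 2 := by
  have hs : 0 < √π := by positivity
  have hv := kA_gamma_val
  have h1 := (kA_gamma_deriv.div_const (√π)).log (by rw [hv]; positivity)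
  have h2 := ((hasDerivAt_inv (show (2 : ℝ) ≠ 0 by norm_num)).mul h1).const_add (Real.log 2 / 2)
  have h4 : (fun p : ℝ => Real.log (khinchineA p)) =ᶠ[nhds 2]
      (fun x => Real.log 2 / 2 + ((fun y : ℝ => y⁻¹) *
        fun y => Real.log (Real.Gamma ((y + 1) / 2) / √π)) x) := by
    filter_upwards [lt_mem_nhds (show (1 : ℝ) < 2 by norm_num)] with p hp
    have hg : 0 < Real.Gamma ((p + 1) / 2) := Real.Gamma_pos_of_pos (by linarith)
    unfold khinchineA
    rw [Real.log_mul (by positivity) (by positivity), Real.log_rpow (by positivity),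
      Real.log_sqrt (by norm_num), one_div]
    rfl
  refine (h2.congr_of_eventuallyEq h4).congr_deriv ?_
  rw [hv, show √π / 2 / √π = 2⁻¹ by field_simp, Real.log_inv]
  field_simp
  ring

/-- The sequence `m ↦ (A_{(2m+2)/(m+3)}^((m−1)/2))^(−(m+1)/(2m))` converges to
`e^(1/2 − γ/4)/2^(1/4)`. -/
theorem khinchineA_seq_limit_odd_right :
    Tendsto
      (fun m : ℕ =>
        (khinchineA ((2 * (m : ℝ) + 2) / ((m : ℝ) + 3)) ^ (((m : ℝ) - 1) / 2)) ^
          (-(((m : ℝ) + 1) / (2 * (m : ℝ)))))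
      atTop
      (nhds (Real.exp (1 / 2 - Real.eulerMascheroniConstant / 4) / (2 : ℝ) ^ ((1 : ℝ) / 4))) := by
  have hinv : Tendsto (fun m : ℕ => ((m : ℝ))⁻¹) atTop (nhds 0) :=
    tendsto_inv_atTop_zero.comp tendsto_natCast_atTop_atTop
  have hinv3 : Tendsto (fun m : ℕ => ((m : ℝ) + 3)⁻¹) atTop (nhds 0) :=
    tendsto_inv_atTop_zero.comp (tendsto_atTop_add_const_right _ _ tendsto_natCast_atTop_atTop)
  have ht : Tendsto (fun m : ℕ => -4 * ((m : ℝ) + 3)⁻¹) atTop (nhdsWithin 0 {0}ᶜ) := by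
    refine tendsto_nhdsWithin_iff.2 ⟨by simpa using hinv3.const_mul (-4), ?_⟩
    refine Eventually.of_forall fun m => ?_
    have : (0 : ℝ) < (m : ℝ) + 3 := by positivity
    simp [this.ne']
  have h1 := (hasDerivAt_iff_tendsto_slope_zero.1 kA_log_deriv).comp ht
  have h2 : Tendsto (fun m : ℕ => (1 - ((m : ℝ))⁻¹ ^ 2) * (1 - 3 * ((m : ℝ) + 3)⁻¹))
      atTop (nhds 1) := by
    have a := ((hinv.pow 2).const_sub 1).mul ((hinv3.const_mul 3).const_sub 1)
    simpa using a
  have h3 := (Real.continuous_exp.tendsto _).comp (h1.mul h2)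
  have e : Real.exp (1 / 2 - Real.eulerMascheroniConstant / 4) / (2 : ℝ) ^ ((1 : ℝ) / 4)
      = Real.exp ((1 / 2 - Real.eulerMascheroniConstant / 4 - Real.log 2 / 4) * 1) := by
    rw [Real.rpow_def_of_pos (by norm_num), ← Real.exp_sub]
    congr 1; ring
  rw [e]
  refine h3.congr' ?_
  filter_upwards [eventually_ge_atTop 1] with m hm
  have hm' : (0 : ℝ) < m := by exact_mod_cast hm
  have hp : (2 : ℝ) + -4 * ((m : ℝ) + 3)⁻¹ = (2 * (m : ℝ) + 2) / ((m : ℝ) + 3) := by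
    field_simp; ring
  have hA : 0 < khinchineA ((2 * (m : ℝ) + 2) / ((m : ℝ) + 3)) := kA_pos (by positivity)
  simp only [Function.comp, smul_eq_mul]
  rw [hp, kA_two, ← Real.rpow_mul hA.le, Real.rpow_def_of_pos hA]
  congr 1
  field_simp
  ring
end

section
/- Let D_n := C_{n+1}/C_n, where C are the real Bohnenblust–Hille constants. Then the sequence n ↦ D_{2n−1}/√(D_{n−1}) (n ≥ 2) converges to 1, and the sequence n ↦ D_{2n}/√(D_n) (n ≥ 1) converges to 1, as n → ∞. -/
open Real Filter

/-- The real Bohnenblust–Hille constants: `C 1 = 1`, `C 2 = √2`, `C 3 = 2^(5/6)`,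
`C m = C (m/2) / A_{2m/(m+2)}^(m/2)` for even `m ≥ 4`, and
`C m = (C ((m−1)/2) / A_{(2m−2)/(m+1)}^((m+1)/2))^((m−1)/(2m)) ·
       (C ((m+1)/2) / A_{(2m+2)/(m+3)}^((m−1)/2))^((m+1)/(2m))` for odd `m ≥ 5`. -/
noncomputable def bhConstR : ℕ → ℝ
  | m =>
    if _h1 : m ≤ 1 then 1
    else if _h2 : m = 2 then Real.sqrt 2
    else if _h3 : m = 3 then (2 : ℝ) ^ ((5 : ℝ) / 6)
    else if _h4 : m % 2 = 0 then
      bhConstR (m / 2) / khinchineA (2 * (m : ℝ) / ((m : ℝ) + 2)) ^ ((m : ℝ) / 2)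
    else
      (bhConstR ((m - 1) / 2) /
          khinchineA ((2 * (m : ℝ) - 2) / ((m : ℝ) + 1)) ^ (((m : ℝ) + 1) / 2)) ^
        (((m : ℝ) - 1) / (2 * (m : ℝ))) *
      (bhConstR ((m + 1) / 2) /
          khinchineA ((2 * (m : ℝ) + 2) / ((m : ℝ) + 3)) ^ (((m : ℝ) - 1) / 2)) ^
        (((m : ℝ) + 1) / (2 * (m : ℝ)))
  termination_by m => m
  decreasing_by all_goals omega

open Topology

namespace BHAux

noncomputable def P (k : ℕ) : ℝ := 2 * (k : ℝ) / ((k : ℝ) + 1)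
noncomputable def a (k : ℕ) : ℝ := - Real.log (khinchineA (P k))
noncomputable def c (k : ℕ) : ℝ := Real.log (bhConstR k)
noncomputable def d (k : ℕ) : ℝ := c (k + 1) - c k
noncomputable def u (k : ℕ) : ℝ := (k : ℝ) * a k

lemma A_pos {p : ℝ} (hp : 0 ≤ p) : 0 < khinchineA p := by
  unfold khinchineA
  have : 0 < Real.Gamma ((p + 1) / 2) := Real.Gamma_pos_of_pos (by linarith)
  positivity

lemma P_nonneg (k : ℕ) : 0 ≤ P k := by unfold P; positivity

lemma bh_even (k : ℕ) (hk : 2 ≤ k) :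
    bhConstR (2 * k) = bhConstR k / khinchineA (P k) ^ (k : ℝ) := by
  rw [bhConstR]
  rw [dif_neg (by omega), dif_neg (by omega), dif_neg (by omega), dif_pos (by omega)]
  have h1 : 2 * k / 2 = k := by omega
  have h2 : 2 * ((2 * k : ℕ) : ℝ) / (((2 * k : ℕ) : ℝ) + 2) = P k := by
    unfold P; push_cast; field_simp
  have h3 : ((2 * k : ℕ) : ℝ) / 2 = k := by push_cast; field_simp
  rw [h1, h2, h3]

lemma bh_odd (k : ℕ) (hk : 2 ≤ k) :
    bhConstR (2 * k + 1) =
      (bhConstR k / khinchineA (P k) ^ ((k : ℝ) + 1)) ^ ((k : ℝ) / (2 * k + 1)) *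
      (bhConstR (k + 1) / khinchineA (P (k + 1)) ^ (k : ℝ)) ^ (((k : ℝ) + 1) / (2 * k + 1)) := by
  rw [bhConstR]
  rw [dif_neg (by omega), dif_neg (by omega), dif_neg (by omega), dif_neg (by omega)]
  have h1 : (2 * k + 1 - 1) / 2 = k := by omega
  have h1' : (2 * k + 1 + 1) / 2 = k + 1 := by omega
  have h2 : (2 * ((2 * k + 1 : ℕ) : ℝ) - 2) / (((2 * k + 1 : ℕ) : ℝ) + 1) = P k := by
    unfold P; push_cast; field_simp; ring
  have h2' : (2 * ((2 * k + 1 : ℕ) : ℝ) + 2) / (((2 * k + 1 : ℕ) : ℝ) + 3) = P (k + 1) := by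
    unfold P; push_cast
    rw [div_eq_div_iff (by positivity) (by positivity)]; ring
  have h3 : (((2 * k + 1 : ℕ) : ℝ) + 1) / 2 = (k : ℝ) + 1 := by push_cast; ring
  have h3' : (((2 * k + 1 : ℕ) : ℝ) - 1) / 2 = (k : ℝ) := by push_cast; ring
  have h4 : (((2 * k + 1 : ℕ) : ℝ) - 1) / (2 * ((2 * k + 1 : ℕ) : ℝ)) = (k : ℝ) / (2 * k + 1) := by
    push_cast; rw [div_eq_div_iff (by positivity) (by positivity)]; ring
  have h4' : (((2 * k + 1 : ℕ) : ℝ) + 1) / (2 * ((2 * k + 1 : ℕ) : ℝ))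
      = ((k : ℝ) + 1) / (2 * k + 1) := by
    push_cast; rw [div_eq_div_iff (by positivity) (by positivity)]; ring
  rw [h1, h1', h2, h2', h3, h3', h4, h4']

lemma C_pos (n : ℕ) : 0 < bhConstR n := by
  induction n using Nat.strong_induction_on with
  | _ n ih =>
    by_cases h : n ≤ 3
    · rw [bhConstR]
      split_ifs
      · norm_num
      · positivity
      · positivity
      all_goals omega
    · rcases Nat.even_or_odd' n with ⟨k, rfl | rfl⟩
      · rw [bh_even k (by omega)]
        exact div_pos (ih k (by omega)) (Real.rpow_pos_of_pos (A_pos (P_nonneg k)) _)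
      · rw [bh_odd k (by omega)]
        have h1 := div_pos (ih k (by omega))
          (Real.rpow_pos_of_pos (A_pos (P_nonneg k)) ((k : ℝ) + 1))
        have h2 := div_pos (ih (k + 1) (by omega))
          (Real.rpow_pos_of_pos (A_pos (P_nonneg (k + 1))) (k : ℝ))
        positivity

lemma log_div_A (n k : ℕ) (x : ℝ) :
    Real.log (bhConstR n / khinchineA (P k) ^ x) = c n + x * a k := by
  rw [Real.log_div (C_pos n).ne' (Real.rpow_pos_of_pos (A_pos (P_nonneg k)) _).ne',
    Real.log_rpow (A_pos (P_nonneg k))]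
  unfold c a; ring

lemma c_even (k : ℕ) (hk : 2 ≤ k) : c (2 * k) = c k + k * a k := by
  rw [← log_div_A, ← bh_even k hk, c]

lemma c_odd (k : ℕ) (hk : 2 ≤ k) :
    c (2 * k + 1) = (k : ℝ) / (2 * k + 1) * (c k + (k + 1) * a k) +
      ((k : ℝ) + 1) / (2 * k + 1) * (c (k + 1) + k * a (k + 1)) := by
  have h1 := div_pos (C_pos k)
    (Real.rpow_pos_of_pos (A_pos (P_nonneg k)) ((k : ℝ) + 1))
  have h2 := div_pos (C_pos (k + 1))
    (Real.rpow_pos_of_pos (A_pos (P_nonneg (k + 1))) (k : ℝ))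
  rw [← log_div_A, ← log_div_A, c, bh_odd k hk,
    Real.log_mul (Real.rpow_pos_of_pos h1 _).ne' (Real.rpow_pos_of_pos h2 _).ne',
    Real.log_rpow h1, Real.log_rpow h2]

/-- weighted mean -/
noncomputable def w (k : ℕ) : ℝ :=
  ((k : ℝ) + 1) / (2 * k + 1) * u k + (k : ℝ) / (2 * k + 1) * u (k + 1)

lemma d_even (k : ℕ) (hk : 2 ≤ k) :
    d (2 * k) = ((k : ℝ) + 1) / (2 * k + 1) * d k + (w k - u k) := by
  unfold d w u
  rw [c_odd k hk, c_even k hk]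
  push_cast
  field_simp
  ring

lemma d_odd (k : ℕ) (hk : 2 ≤ k) :
    d (2 * k + 1) = (k : ℝ) / (2 * k + 1) * d k + (u (k + 1) - w k) := by
  unfold d w u
  rw [c_odd k hk, show 2 * k + 1 + 1 = 2 * (k + 1) by ring, c_even (k + 1) (by omega)]
  push_cast
  field_simp
  ring

lemma A_two : khinchineA 2 = 1 := by
  unfold khinchineA
  have h : Real.Gamma ((2 + 1) / 2) = 1 / 2 * Real.sqrt π := by
    rw [show ((2 : ℝ) + 1) / 2 = 1 / 2 + 1 by norm_num, Real.Gamma_add_one (by norm_num),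
      Real.Gamma_one_half_eq]
  rw [h, mul_div_assoc, div_self (by positivity), mul_one, ← Real.sqrt_eq_rpow,
    ← Real.sqrt_mul (by norm_num)]
  norm_num

lemma diffA : DifferentiableAt ℝ (fun p : ℝ => - Real.log (khinchineA p)) 2 := by
  have hG : DifferentiableAt ℝ (fun p : ℝ => Real.Gamma ((p + 1) / 2)) 2 := by
    have h := Real.differentiableAt_Gamma (s := ((2 : ℝ) + 1) / 2) (by
      intro m; have : (0 : ℝ) ≤ m := Nat.cast_nonneg m
      intro h; linarith)
    exact DifferentiableAt.comp (2 : ℝ) (g := Real.Gamma) (f := fun p : ℝ => (p + 1) / 2) h (by fun_prop)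
  have hpos : 0 < Real.Gamma (((2 : ℝ) + 1) / 2) := Real.Gamma_pos_of_pos (by norm_num)
  have hA : DifferentiableAt ℝ khinchineA 2 := by
    unfold khinchineA
    refine DifferentiableAt.const_mul ?_ _
    refine DifferentiableAt.rpow (hG.div_const _) ?_ (by positivity)
    exact DifferentiableAt.div (by fun_prop) (by fun_prop) (by norm_num)
  exact (hA.log (by rw [A_two]; norm_num)).neg

lemma lim_u : ∃ L : ℝ, Tendsto u atTop (𝓝 L) := by
  set h : ℝ → ℝ := fun t => - Real.log (khinchineA (2 - 2 * t)) with hh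
  have hd : DifferentiableAt ℝ h 0 := by
    have := diffA
    refine DifferentiableAt.comp (0 : ℝ) (g := fun p : ℝ => - Real.log (khinchineA p))
      (f := fun t : ℝ => 2 - 2 * t) ?_ (by fun_prop)
    simpa using this
  have h0 : h 0 = 0 := by simp [hh, A_two]
  have hs := hasDerivAt_iff_tendsto_slope_zero.1 hd.hasDerivAt
  have ht : Tendsto (fun k : ℕ => 1 / ((k : ℝ) + 1)) atTop (𝓝[≠] 0) := by
    refine tendsto_nhdsWithin_iff.2 ⟨tendsto_one_div_add_atTop_nhds_zero_nat, ?_⟩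
    refine Eventually.of_forall fun k => ?_
    have : 1 / ((k : ℝ) + 1) ≠ 0 := by positivity
    exact this
  have h1 := hs.comp ht
  have h2 := tendsto_natCast_div_add_atTop (1 : ℝ)
  refine ⟨1 * deriv h 0, (h2.mul h1).congr fun k => ?_⟩
  have hP : 2 - 2 * (1 / ((k : ℝ) + 1)) = P k := by unfold P; field_simp; ring
  have h3 : h (1 / ((k : ℝ) + 1)) = a k := by
    simp only [hh]; rw [hP, a]
  simp only [Function.comp, zero_add, h0, sub_zero, smul_eq_mul, h3, u]
  field_simp

lemma lim_half : Tendsto (fun k : ℕ => (k : ℝ) / (2 * k + 1)) atTop (𝓝 (1 / 2)) := by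
  have h2 := (tendsto_natCast_div_add_atTop (1 / 2 : ℝ)).const_mul (1 / 2)
  rw [mul_one] at h2
  refine h2.congr fun k => ?_
  field_simp

lemma lim_inv : Tendsto (fun k : ℕ => 1 / (2 * (k : ℝ) + 1)) atTop (𝓝 0) := by
  have h := (lim_half.const_mul 2).const_sub 1
  norm_num at h
  refine h.congr fun k => ?_
  field_simp
  ring

lemma lim_half' : Tendsto (fun k : ℕ => ((k : ℝ) + 1) / (2 * k + 1)) atTop (𝓝 (1 / 2)) := by
  have h := lim_half.add lim_inv
  rw [add_zero] at h
  refine h.congr fun k => ?_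
  field_simp

lemma lim_w {L : ℝ} (hu : Tendsto u atTop (𝓝 L)) : Tendsto w atTop (𝓝 L) := by
  have hu' := (tendsto_add_atTop_iff_nat 1).2 hu
  have h := (lim_half'.mul hu).add (lim_half.mul hu')
  have e : 1 / 2 * L + 1 / 2 * L = L := by ring
  rw [e] at h
  exact h

lemma lim_e : Tendsto (fun k => w k - u k) atTop (𝓝 0) := by
  obtain ⟨L, hu⟩ := lim_u
  simpa using (lim_w hu).sub hu

lemma lim_o : Tendsto (fun k => u (k + 1) - w k) atTop (𝓝 0) := by
  obtain ⟨L, hu⟩ := lim_u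
  simpa using ((tendsto_add_atTop_iff_nat 1).2 hu).sub (lim_w hu)

lemma bdd_of_lim {f : ℕ → ℝ} (h : Tendsto f atTop (𝓝 0)) : ∃ B, ∀ n, |f n| ≤ B := by
  obtain ⟨B, hB⟩ := h.abs.bddAbove_range
  exact ⟨B, fun n => hB ⟨n, rfl⟩⟩

lemma d_bdd : ∃ M, ∀ n, |d n| ≤ M := by
  obtain ⟨B1, h1⟩ := bdd_of_lim lim_e
  obtain ⟨B2, h2⟩ := bdd_of_lim lim_o
  have p1 : 0 ≤ B1 := (abs_nonneg _).trans (h1 0)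
  have p2 : 0 ≤ B2 := (abs_nonneg _).trans (h2 0)
  refine ⟨3 * B1 + 3 * B2 + |d 0| + |d 1| + |d 2| + |d 3|, fun n => ?_⟩
  have q0 := abs_nonneg (d 0)
  have q1 := abs_nonneg (d 1)
  have q2 := abs_nonneg (d 2)
  have q3 := abs_nonneg (d 3)
  set M := 3 * B1 + 3 * B2 + |d 0| + |d 1| + |d 2| + |d 3| with hM
  have key : ∀ (r e x : ℝ), 0 ≤ r → r ≤ 2 / 3 → |e| ≤ B1 + B2 → |x| ≤ M → |r * x + e| ≤ M := by
    intro r e x hr hr' he hx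
    have : |r * x + e| ≤ r * |x| + |e| := by
      refine (abs_add_le _ _).trans ?_
      rw [abs_mul, abs_of_nonneg hr]
    have h3 : r * |x| ≤ 2 / 3 * M := mul_le_mul hr' hx (abs_nonneg _) (by norm_num)
    linarith
  induction n using Nat.strong_induction_on with
  | _ n ih =>
    by_cases h : n ≤ 3
    · interval_cases n <;> linarith
    · rcases Nat.even_or_odd' n with ⟨k, rfl | rfl⟩
      · rw [d_even k (by omega)]
        have hk : (2 : ℝ) ≤ k := by exact_mod_cast (show 2 ≤ k by omega)
        refine key _ _ _ (by positivity) ?_ ((h1 k).trans (by linarith)) (ih k (by omega))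
        rw [div_le_div_iff₀ (by positivity) (by norm_num)]; linarith
      · rw [d_odd k (by omega)]
        have hk : (2 : ℝ) ≤ k := by exact_mod_cast (show 2 ≤ k by omega)
        refine key _ _ _ (by positivity) ?_ ((h2 k).trans (by linarith)) (ih k (by omega))
        rw [div_le_div_iff₀ (by positivity) (by norm_num)]; linarith

lemma lim_d : Tendsto (fun k : ℕ => 1 / (2 * (k : ℝ) + 1) * d k / 2) atTop (𝓝 0) := by
  obtain ⟨M, hM⟩ := d_bdd
  have h := (lim_inv.mul_const M)
  rw [zero_mul] at h
  refine squeeze_zero_norm (fun k => ?_) h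
  rw [Real.norm_eq_abs, abs_div, abs_mul, abs_of_nonneg (show 0 ≤ 1 / (2 * (k : ℝ) + 1) by positivity)]
  have : 1 / (2 * (k : ℝ) + 1) * |d k| ≤ 1 / (2 * (k : ℝ) + 1) * M :=
    mul_le_mul_of_nonneg_left (hM k) (by positivity)
  have h0 : 0 ≤ 1 / (2 * (k : ℝ) + 1) * |d k| := by positivity
  rw [abs_of_pos (by norm_num : (0 : ℝ) < 2)]
  linarith

lemma lim_even : Tendsto (fun k : ℕ => d (2 * k) - d k / 2) atTop (𝓝 0) := by
  have h := lim_d.add lim_e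
  rw [add_zero] at h
  refine h.congr' ?_
  filter_upwards [eventually_ge_atTop 2] with k hk
  rw [d_even k hk]
  field_simp
  ring

lemma lim_odd : Tendsto (fun k : ℕ => d (2 * k + 1) - d k / 2) atTop (𝓝 0) := by
  have h := lim_d.neg.add lim_o
  rw [neg_zero, add_zero] at h
  refine h.congr' ?_
  filter_upwards [eventually_ge_atTop 2] with k hk
  rw [d_odd k hk]
  field_simp
  ring

lemma ratio (n : ℕ) : bhConstR (n + 1) / bhConstR n = Real.exp (d n) := by
  rw [d, c, c, Real.exp_sub, Real.exp_log (C_pos _), Real.exp_log (C_pos _)]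

lemma quot (m n : ℕ) : (bhConstR (m + 1) / bhConstR m) /
    Real.sqrt (bhConstR (n + 1) / bhConstR n) = Real.exp (d m - d n / 2) := by
  rw [ratio, ratio, ← Real.exp_half, Real.exp_sub]

end BHAux

/-- With `D_n := C_{n+1}/C_n`, both `D_{2n−1}/√(D_{n−1})` and `D_{2n}/√(D_n)` converge to `1`. -/
theorem bhConstR_D_asymptotics :
    Tendsto
      (fun n : ℕ =>
        (bhConstR (2 * n - 1 + 1) / bhConstR (2 * n - 1)) /
          Real.sqrt (bhConstR (n - 1 + 1) / bhConstR (n - 1)))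
      atTop (nhds 1) ∧
    Tendsto
      (fun n : ℕ =>
        (bhConstR (2 * n + 1) / bhConstR (2 * n)) /
          Real.sqrt (bhConstR (n + 1) / bhConstR n))
      atTop (nhds 1) := by
  refine ⟨?_, ?_⟩
  · refine (tendsto_add_atTop_iff_nat 1).1 ?_
    have h := (Real.continuous_exp.tendsto 0).comp BHAux.lim_odd
    rw [Real.exp_zero] at h
    refine h.congr fun k => ?_
    have h1 : 2 * (k + 1) - 1 = 2 * k + 1 := by omega
    rw [h1, Nat.add_sub_cancel, BHAux.quot]
    rfl
  · have h := (Real.continuous_exp.tendsto 0).comp BHAux.lim_even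
    rw [Real.exp_zero] at h
    refine h.congr fun k => ?_
    rw [BHAux.quot]
    rfl
end

section
/- Let D : ℕ → ℝ be a sequence with D_n ≥ 1 for every n, such that the sequence n ↦ D_{2n−1}/√(D_{n−1}) (n ≥ 2) converges to 1 and the sequence n ↦ D_{2n}/√(D_n) converges to 1 as n → ∞. Let K > 1 and suppose there exists m₀ such that D_n < K for all n > m₀. Then there exists m₁ ≥ m₀ such that D_n < K^(5/8) for all n > m₁. -/
open Real Filter

/-- Claim 2: if `D_n ≥ 1` for all `n`, `D_{2n−1}/√(D_{n−1}) → 1`, `D_{2n}/√(D_n) → 1`,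
`K > 1`, and `D_n < K` for all `n > m₀`, then there exists `m₁ ≥ m₀` such that
`D_n < K^(5/8)` for all `n > m₁`. -/
theorem claim2 (D : ℕ → ℝ) (hD : ∀ n, 1 ≤ D n)
    (hodd : Tendsto (fun n : ℕ => D (2 * n - 1) / Real.sqrt (D (n - 1))) atTop (nhds 1))
    (heven : Tendsto (fun n : ℕ => D (2 * n) / Real.sqrt (D n)) atTop (nhds 1))
    (K : ℝ) (hK : 1 < K) (m₀ : ℕ) (hbound : ∀ n > m₀, D n < K) :
    ∃ m₁ : ℕ, m₀ ≤ m₁ ∧ ∀ n > m₁, D n < K ^ ((5 : ℝ) / 8) := by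
  have h1 : (1:ℝ) < K ^ ((1:ℝ)/8) := Real.one_lt_rpow hK (by norm_num)
  obtain ⟨N, hN⟩ := eventually_atTop.1
    ((hodd.eventually (gt_mem_nhds h1)).and (heven.eventually (gt_mem_nhds h1)))
  have key : ∀ a b : ℕ, m₀ < b → D a / Real.sqrt (D b) < K ^ ((1:ℝ)/8) →
      D a < K ^ ((5:ℝ)/8) := by
    intro a b hb h
    have hDb := hD b
    have hs : 0 < Real.sqrt (D b) := Real.sqrt_pos.2 (by linarith)
    rw [div_lt_iff₀ hs] at h
    have h2 : Real.sqrt (D b) < Real.sqrt K := Real.sqrt_lt_sqrt (by linarith) (hbound b hb)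
    have h3 : K ^ ((5:ℝ)/8) = K ^ ((1:ℝ)/8) * Real.sqrt K := by
      rw [Real.sqrt_eq_rpow, ← Real.rpow_add (by linarith)]
      norm_num
    rw [h3]
    exact h.trans (mul_lt_mul_of_pos_left h2 (by linarith))
  refine ⟨2 * (N + m₀ + 2), by omega, fun n hn => ?_⟩
  rcases Nat.even_or_odd' n with ⟨k, rfl | rfl⟩
  · exact key _ k (by omega) (hN k (by omega)).2
  · have h := (hN (k + 1) (by omega)).1
    have e : 2 * (k + 1) - 1 = 2 * k + 1 := by omega
    rw [e, Nat.add_sub_cancel] at h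
    exact key _ k (by omega) h
end

section
/- Let D : ℕ → ℝ be a sequence with D_n ≥ 1 for every n, such that the sequence n ↦ D_{2n−1}/√(D_{n−1}) (n ≥ 2) converges to 1 and the sequence n ↦ D_{2n}/√(D_n) converges to 1 as n → ∞. Let L > 1 and suppose there exists m₀ such that D_n < L for all n > m₀. Then there exists m₂ ≥ m₀ such that D_n < √L for all n > m₂. -/
open Real Filter

lemma step_aux (D : ℕ → ℝ) (hD : ∀ n, 1 ≤ D n)
    (hodd : Tendsto (fun n : ℕ => D (2 * n - 1) / Real.sqrt (D (n - 1))) atTop (nhds 1))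
    (heven : Tendsto (fun n : ℕ => D (2 * n) / Real.sqrt (D n)) atTop (nhds 1))
    (s : ℝ) (hs : 1 < s) (B : ℝ) (hB : 0 < B) (m : ℕ) (hb : ∀ n > m, D n < B ^ 2) :
    ∃ m' : ℕ, ∀ n > m', D n < s * B := by
  obtain ⟨a, ha⟩ := eventually_atTop.1 (hodd.eventually (gt_mem_nhds hs))
  obtain ⟨b, hb'⟩ := eventually_atTop.1 (heven.eventually (gt_mem_nhds hs))
  have key : ∀ k n, n > m → D k / Real.sqrt (D n) < s → D k < s * B := by
    intro k n hn h
    have hp : 0 < Real.sqrt (D n) := Real.sqrt_pos.2 (by linarith [hD n])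
    have h2 : Real.sqrt (D n) < B := (Real.sqrt_lt' hB).2 (hb n hn)
    rw [div_lt_iff₀ hp] at h
    nlinarith
  refine ⟨2 * (a + b + m + 2), fun n hn => ?_⟩
  rcases Nat.even_or_odd' n with ⟨k, rfl | rfl⟩
  · exact key _ k (by omega) (hb' k (by omega))
  · have := ha (k + 1) (by omega)
    exact key _ k (by omega) (by simpa [Nat.mul_add] using this)

/-- Claim 3: if `D_n ≥ 1` for all `n`, `D_{2n−1}/√(D_{n−1}) → 1`, `D_{2n}/√(D_n) → 1`,
`L > 1`, and `D_n < L` for all `n > m₀`, then there exists `m₂ ≥ m₀` such that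
`D_n < √L` for all `n > m₂`. -/
theorem claim3 (D : ℕ → ℝ) (hD : ∀ n, 1 ≤ D n)
    (hodd : Tendsto (fun n : ℕ => D (2 * n - 1) / Real.sqrt (D (n - 1))) atTop (nhds 1))
    (heven : Tendsto (fun n : ℕ => D (2 * n) / Real.sqrt (D n)) atTop (nhds 1))
    (L : ℝ) (hL : 1 < L) (m₀ : ℕ) (hbound : ∀ n > m₀, D n < L) :
    ∃ m₂ : ℕ, m₀ ≤ m₂ ∧ ∀ n > m₂, D n < Real.sqrt L := by
  obtain ⟨s, hs, hsL⟩ : ∃ s : ℝ, 1 < s ∧ s ^ 8 = L := by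
    refine ⟨√√√L, ?_, ?_⟩
    · simpa [Real.lt_sqrt] using hL
    · rw [show (√√√L) ^ 8 = (((√√√L) ^ 2) ^ 2) ^ 2 by ring, Real.sq_sqrt (by positivity),
        Real.sq_sqrt (by positivity), Real.sq_sqrt (by linarith)]
  have hq : Real.sqrt L = s ^ 4 := by
    rw [← hsL, show s ^ 8 = (s ^ 4) ^ 2 by ring, Real.sqrt_sq (by positivity)]
  obtain ⟨m1, h1⟩ := step_aux D hD hodd heven s hs (s ^ 4) (by positivity) m₀
    (fun n hn => by have := hbound n hn; rw [← hsL] at this; linarith [pow_mul s 4 2])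
  obtain ⟨m2, h2⟩ := step_aux D hD hodd heven s hs (s ^ 3) (by positivity) m1
    (fun n hn => by
      have := h1 n hn
      have h5 : 0 < s ^ 5 := by positivity
      nlinarith)
  refine ⟨m₀ + m2, by omega, fun n hn => ?_⟩
  rw [hq]
  have := h2 n (by omega)
  linarith [pow_succ' s 3]
end

section
/- Let D : ℕ → ℝ be a sequence with D_n ≥ 1 for every n, such that the sequence n ↦ D_{2n−1}/√(D_{n−1}) (n ≥ 2) converges to 1 and the sequence n ↦ D_{2n}/√(D_n) converges to 1 as n → ∞. Let C > 1 be such that D_n < C for all n. Then for every nonnegative integer s there exists a positive integer n₀ (depending on s) such that D_n < C^(2^(−s)) for all n > n₀. -/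
open Real Filter

/-- Claim 4: if `D_n ≥ 1` for all `n`, `D_{2n−1}/√(D_{n−1}) → 1`, `D_{2n}/√(D_n) → 1`,
`C > 1`, and `D_n < C` for all `n`, then for every `s` there exists a positive `n₀`
such that `D_n < C^(2^(−s))` for all `n > n₀`. -/
theorem claim4 (D : ℕ → ℝ) (hD : ∀ n, 1 ≤ D n)
    (hodd : Tendsto (fun n : ℕ => D (2 * n - 1) / Real.sqrt (D (n - 1))) atTop (nhds 1))
    (heven : Tendsto (fun n : ℕ => D (2 * n) / Real.sqrt (D n)) atTop (nhds 1))
    (C : ℝ) (hC : 1 < C) (hbound : ∀ n, D n < C) :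
    ∀ s : ℕ, ∃ n₀ : ℕ, 0 < n₀ ∧ ∀ n > n₀, D n < C ^ ((2 : ℝ) ^ (-(s : ℝ))) := by
  have key : ∀ t : ℕ, ∃ N : ℕ, ∀ n ≥ N, D n < C ^ (((3 : ℝ) / 4) ^ t) := by
    intro t
    induction t with
    | zero => exact ⟨0, fun n _ => by simpa using hbound n⟩
    | succ t ih =>
      obtain ⟨N, hN⟩ := ih
      have hC0 : 0 < C := by linarith
      set a : ℝ := ((3 : ℝ) / 4) ^ t with ha
      have ha0 : 0 < a := by positivity
      have hK : 1 < C ^ (a / 4) := Real.one_lt_rpow hC (by positivity)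
      obtain ⟨N1, h1⟩ := eventually_atTop.1 (hodd.eventually_lt_const hK)
      obtain ⟨N2, h2⟩ := eventually_atTop.1 (heven.eventually_lt_const hK)
      have step : ∀ x m, N ≤ m → x / Real.sqrt (D m) < C ^ (a / 4) →
          x < C ^ (((3 : ℝ) / 4) ^ (t + 1)) := by
        intro x m hm hx
        have hs : 0 < Real.sqrt (D m) := Real.sqrt_pos.2 (by linarith [hD m])
        rw [div_lt_iff₀ hs] at hx
        have hs2 : Real.sqrt (D m) ≤ C ^ (a / 2) := by
          apply Real.sqrt_le_iff.2
          refine ⟨by positivity, ?_⟩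
          rw [sq, ← Real.rpow_add hC0, add_halves]
          exact (hN m hm).le
        have he : ((3 : ℝ) / 4) ^ (t + 1) = a / 4 + a / 2 := by
          rw [pow_succ, ← ha]; ring
        rw [he, Real.rpow_add hC0]
        exact hx.trans_le (mul_le_mul_of_nonneg_left hs2 (by positivity))
      refine ⟨2 * (N + N1 + N2) + 2, fun n hn => ?_⟩
      rcases Nat.even_or_odd' n with ⟨m, rfl | rfl⟩
      · exact step _ m (by omega) (h2 m (by omega))
      · have h := h1 (m + 1) (by omega)
        have e1 : 2 * (m + 1) - 1 = 2 * m + 1 := by omega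
        have e2 : m + 1 - 1 = m := by omega
        rw [e1, e2] at h
        exact step _ m (by omega) h
  intro s
  have hp : (0 : ℝ) < (2 : ℝ) ^ (-(s : ℝ)) := by positivity
  obtain ⟨t, ht⟩ := exists_pow_lt_of_lt_one hp (by norm_num : (3 : ℝ) / 4 < 1)
  obtain ⟨N, hN⟩ := key t
  refine ⟨N + 1, by omega, fun n hn => (hN n (by omega)).trans ?_⟩
  exact Real.rpow_lt_rpow_of_exponent_lt hC ht
end

section
/- Let D : ℕ → ℝ be a sequence with D_n ≥ 1 for every n, bounded above by some constant C > 1, and such that the sequence n ↦ D_{2n−1}/√(D_{n−1}) (n ≥ 2) converges to 1 and the sequence n ↦ D_{2n}/√(D_n) converges to 1 as n → ∞. Then D_n converges to 1 as n → ∞. -/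
open Real Filter

lemma step_aux_s15 (x y C e : ℝ) (hy : 1 ≤ y) (hyC : y ≤ C) (he : 0 < e)
    (h : x / Real.sqrt y < 1 + e / (2 * C)) : x - 1 ≤ (y - 1) / 2 + e / 2 := by
  have hs : 1 ≤ Real.sqrt y := Real.one_le_sqrt.2 hy
  have hq : Real.sqrt y * Real.sqrt y = y := Real.mul_self_sqrt (by linarith)
  have hC : 0 < C := by linarith
  rw [div_lt_iff₀ (by linarith)] at h
  have h1 : Real.sqrt y ≤ C := by nlinarith
  have h2 : Real.sqrt y ≤ (1 + y) / 2 := by nlinarith [sq_nonneg (Real.sqrt y - 1)]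
  have h3 : e / (2 * C) * Real.sqrt y ≤ e / (2 * C) * C :=
    mul_le_mul_of_nonneg_left h1 (by positivity)
  have h4 : e / (2 * C) * C = e / 2 := by field_simp
  linarith

/-- If `D_n ≥ 1` for all `n`, `D` is bounded above by a constant `C > 1`, and both
`D_{2n−1}/√(D_{n−1}) → 1` and `D_{2n}/√(D_n) → 1`, then `D_n → 1`. -/
theorem D_tendsto_one (D : ℕ → ℝ) (hD : ∀ n, 1 ≤ D n)
    (C : ℝ) (hC : 1 < C) (hbound : ∀ n, D n ≤ C)
    (hodd : Tendsto (fun n : ℕ => D (2 * n - 1) / Real.sqrt (D (n - 1))) atTop (nhds 1))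
    (heven : Tendsto (fun n : ℕ => D (2 * n) / Real.sqrt (D n)) atTop (nhds 1)) :
    Tendsto D atTop (nhds 1) := by
  have key : ∀ e : ℝ, 0 < e → ∀ j : ℕ, ∃ N, ∀ n ≥ N, D n - 1 ≤ C * (1 / 2) ^ j + e := by
    intro e he j
    have hlt : (1 : ℝ) < 1 + e / (2 * C) := by
      have : 0 < e / (2 * C) := by positivity
      linarith
    obtain ⟨A, hA⟩ := eventually_atTop.1 (hodd.eventually (gt_mem_nhds hlt))
    obtain ⟨B, hB⟩ := eventually_atTop.1 (heven.eventually (gt_mem_nhds hlt))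
    induction j with
    | zero => exact ⟨0, fun n _ => by have := hbound n; simp; linarith⟩
    | succ j ih =>
      obtain ⟨N, hN⟩ := ih
      refine ⟨2 * (N + A + B) + 2, fun m hm => ?_⟩
      rw [pow_succ]
      rcases Nat.even_or_odd' m with ⟨k, rfl | rfl⟩
      · have h1 := step_aux_s15 _ _ C e (hD k) (hbound k) he (hB k (by omega))
        have h2 := hN k (by omega)
        linarith
      · have h0 := hA (k + 1) (by omega)
        have e1 : 2 * (k + 1) - 1 = 2 * k + 1 := by omega
        rw [e1, Nat.add_sub_cancel] at h0
        have h1 := step_aux_s15 _ _ C e (hD k) (hbound k) he h0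
        have h2 := hN k (by omega)
        linarith
  rw [Metric.tendsto_atTop]
  intro e he
  obtain ⟨j, hj⟩ := exists_pow_lt_of_lt_one (show 0 < e / 2 / C by positivity)
    (show (1 / 2 : ℝ) < 1 by norm_num)
  obtain ⟨N, hN⟩ := key (e / 2) (by positivity) j
  refine ⟨N, fun n hn => ?_⟩
  have h1 := hN n hn
  rw [lt_div_iff₀ (by linarith)] at hj
  rw [Real.dist_eq, abs_of_nonneg (by linarith [hD n])]
  linarith
end

section
/- For the real Bohnenblust–Hille constants C, the sequence m ↦ C_m/C_{m−1} (m ≥ 2) converges to 1 as m → ∞. -/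
open Real Filter

lemma khA_pos {p : ℝ} (hp : 0 ≤ p) : 0 < khinchineA p := by
  unfold khinchineA
  have h1 : 0 < Real.Gamma ((p + 1) / 2) := Real.Gamma_pos_of_pos (by linarith)
  have h2 : 0 < Real.sqrt π := Real.sqrt_pos.2 Real.pi_pos
  positivity

lemma khA_two : khinchineA 2 = 1 := by
  unfold khinchineA
  have h2 : 0 < Real.sqrt π := Real.sqrt_pos.2 Real.pi_pos
  have h1 : Real.Gamma ((2 + 1) / 2) = 1 / 2 * Real.sqrt π := by
    rw [show ((2 : ℝ) + 1) / 2 = 1 / 2 + 1 by norm_num, Real.Gamma_add_one (by norm_num),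
      Real.Gamma_one_half_eq]
  rw [h1, mul_div_assoc, div_self h2.ne', mul_one, ← Real.sqrt_eq_rpow,
    ← Real.sqrt_mul (by norm_num)]
  norm_num

lemma khA_diff : DifferentiableAt ℝ (fun p => Real.log (khinchineA p)) 2 := by
  have h2 : 0 < Real.sqrt π := Real.sqrt_pos.2 Real.pi_pos
  have hG : DifferentiableAt ℝ (fun p : ℝ => Real.Gamma ((p + 1) / 2)) 2 := by
    have h0 : DifferentiableAt ℝ Real.Gamma (((2 : ℝ) + 1) / 2) := by
      apply Real.differentiableAt_Gamma
      intro m hm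
      have : (0 : ℝ) ≤ m := Nat.cast_nonneg m
      linarith
    exact DifferentiableAt.comp (2 : ℝ) (g := Real.Gamma) (f := fun p : ℝ => (p + 1) / 2) h0
      (by fun_prop)
  have hp : 0 < Real.Gamma (((2 : ℝ) + 1) / 2) := Real.Gamma_pos_of_pos (by norm_num)
  have hA := khA_pos (p := 2) (by norm_num)
  refine DifferentiableAt.log ?_ hA.ne'
  unfold khinchineA
  refine DifferentiableAt.const_mul ?_ _
  refine DifferentiableAt.rpow (hG.div_const _) ?_ (div_pos hp h2).ne'
  exact (differentiableAt_const _).div differentiableAt_id (by norm_num)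

noncomputable def bhp (k : ℕ) : ℝ := 2 * (k : ℝ) / ((k : ℝ) + 1)

noncomputable def bhg (k : ℕ) : ℝ := -((k : ℝ) * Real.log (khinchineA (bhp k)))

lemma bhp_tendsto : Tendsto bhp atTop (nhds 2) := by
  have h := (tendsto_natCast_div_add_atTop (𝕜 := ℝ) 1).const_mul 2
  rw [mul_one] at h
  refine h.congr fun k => ?_
  unfold bhp
  ring

lemma bhg_tendsto : ∃ L, Tendsto bhg atTop (nhds L) := by
  have hd := khA_diff.hasDerivAt
  rw [hasDerivAt_iff_tendsto_slope] at hd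
  have h1 : Tendsto bhp atTop (nhdsWithin 2 {2}ᶜ) := by
    rw [tendsto_nhdsWithin_iff]
    refine ⟨bhp_tendsto, Eventually.of_forall fun k => ?_⟩
    simp only [Set.mem_compl_iff, Set.mem_singleton_iff, bhp]
    intro h
    have : (0 : ℝ) < (k : ℝ) + 1 := by positivity
    field_simp at h
    linarith
  refine ⟨_, ((hd.comp h1).mul bhp_tendsto).congr fun k => ?_⟩
  have hk : (0 : ℝ) < (k : ℝ) + 1 := by positivity
  have e : bhp k - 2 = -(2 / ((k : ℝ) + 1)) := by
    unfold bhp; field_simp; ring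
  simp only [Function.comp, slope_def_field, khA_two, Real.log_one, sub_zero, e, bhg]
  generalize Real.log (khinchineA (bhp k)) = z
  unfold bhp
  field_simp

lemma bh_even (k : ℕ) (hk : 2 ≤ k) :
    bhConstR (2 * k) = bhConstR k / khinchineA (bhp k) ^ (k : ℝ) := by
  rw [bhConstR, dif_neg (by omega), dif_neg (by omega), dif_neg (by omega), dif_pos (by omega)]
  have hk0 : (0 : ℝ) < (k : ℝ) + 1 := by positivity
  rw [show 2 * k / 2 = k by omega]
  congr 2
  · congr 1
    unfold bhp; push_cast; field_simp; try ring
  · push_cast; ring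

lemma bh_odd (k : ℕ) (hk : 2 ≤ k) :
    bhConstR (2 * k + 1) =
      (bhConstR k / khinchineA (bhp k) ^ ((k : ℝ) + 1)) ^ ((k : ℝ) / (2 * k + 1)) *
      (bhConstR (k + 1) / khinchineA (bhp (k + 1)) ^ (k : ℝ)) ^
        (((k : ℝ) + 1) / (2 * k + 1)) := by
  rw [bhConstR, dif_neg (by omega), dif_neg (by omega), dif_neg (by omega), dif_neg (by omega)]
  have hk0 : (0 : ℝ) < (k : ℝ) + 1 := by positivity
  have hk2 : (0 : ℝ) < (k : ℝ) + 2 := by positivity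
  have hk1 : (0 : ℝ) < 2 * (k : ℝ) + 1 := by positivity
  rw [show (2 * k + 1 - 1) / 2 = k by omega, show (2 * k + 1 + 1) / 2 = k + 1 by omega]
  have e1 : (2 * ((2 * k + 1 : ℕ) : ℝ) - 2) / (((2 * k + 1 : ℕ) : ℝ) + 1) = bhp k := by
    unfold bhp; push_cast
    rw [div_eq_div_iff (by positivity) (by positivity)]; ring
  have e2 : (2 * ((2 * k + 1 : ℕ) : ℝ) + 2) / (((2 * k + 1 : ℕ) : ℝ) + 3) = bhp (k + 1) := by
    unfold bhp; push_cast
    rw [div_eq_div_iff (by positivity) (by positivity)]; ring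
  have e3 : (((2 * k + 1 : ℕ) : ℝ) + 1) / 2 = (k : ℝ) + 1 := by push_cast; ring
  have e4 : (((2 * k + 1 : ℕ) : ℝ) - 1) / 2 = (k : ℝ) := by push_cast; ring
  have e5 : (((2 * k + 1 : ℕ) : ℝ) - 1) / (2 * ((2 * k + 1 : ℕ) : ℝ)) = (k : ℝ) / (2 * k + 1) := by
    push_cast
    rw [div_eq_div_iff (by positivity) (by positivity)]; ring
  have e6 : (((2 * k + 1 : ℕ) : ℝ) + 1) / (2 * ((2 * k + 1 : ℕ) : ℝ))
      = ((k : ℝ) + 1) / (2 * k + 1) := by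
    push_cast
    rw [div_eq_div_iff (by positivity) (by positivity)]; ring
  rw [e1, e2, e3, e4, e5, e6]

lemma bhA_pos (k : ℕ) : 0 < khinchineA (bhp k) := khA_pos (by unfold bhp; positivity)

lemma bh_pos (m : ℕ) : 0 < bhConstR m := by
  induction m using Nat.strong_induction_on with
  | _ m ih =>
    by_cases h : m ≤ 3
    · rw [bhConstR]
      by_cases h1 : m ≤ 1
      · rw [dif_pos h1]; norm_num
      · rw [dif_neg h1]
        by_cases h2 : m = 2
        · rw [dif_pos h2]; positivity
        · rw [dif_neg h2, dif_pos (by omega)]; positivity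
    · obtain ⟨k, hk | hk⟩ := Nat.even_or_odd' m
      · rw [hk, bh_even k (by omega)]
        have := ih k (by omega)
        have := bhA_pos k
        positivity
      · rw [hk, bh_odd k (by omega)]
        have := ih k (by omega)
        have := ih (k + 1) (by omega)
        have := bhA_pos k
        have := bhA_pos (k + 1)
        positivity

lemma bh_log_even (k : ℕ) (hk : 2 ≤ k) :
    Real.log (bhConstR (2 * k)) = Real.log (bhConstR k) + bhg k := by
  have h1 := bh_pos k
  have h2 := bhA_pos k
  rw [bh_even k hk, Real.log_div (by positivity) (by positivity), Real.log_rpow h2, bhg]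
  ring

lemma bh_log_odd (k : ℕ) (hk : 2 ≤ k) :
    (2 * (k : ℝ) + 1) * Real.log (bhConstR (2 * k + 1)) =
      k * Real.log (bhConstR k) + (k + 1) * bhg k + (k + 1) * Real.log (bhConstR (k + 1))
       + k * bhg (k + 1) := by
  have h1 := bh_pos k
  have h2 := bhA_pos k
  have h1' := bh_pos (k + 1)
  have h2' := bhA_pos (k + 1)
  have hk1 : (0 : ℝ) < 2 * (k : ℝ) + 1 := by positivity
  rw [bh_odd k hk, Real.log_mul (by positivity) (by positivity), Real.log_rpow (by positivity),
    Real.log_rpow (by positivity),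
    Real.log_div (by positivity) (by positivity), Real.log_div (by positivity) (by positivity),
    Real.log_rpow h2, Real.log_rpow h2', bhg, bhg]
  push_cast
  field_simp
  ring

noncomputable def bhd (m : ℕ) : ℝ := Real.log (bhConstR (m + 1)) - Real.log (bhConstR m)

lemma bhd_even (k : ℕ) (hk : 2 ≤ k) :
    |bhd (2 * k)| ≤ 2 / 3 * |bhd k| + |bhg (k + 1) - bhg k| := by
  have h1 := bh_log_even k hk
  have h2 := bh_log_odd k hk
  have hk2 : (2 : ℝ) ≤ k := by exact_mod_cast hk
  have hk1 : (0 : ℝ) < 2 * (k : ℝ) + 1 := by positivity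
  have e : bhd (2 * k) = ((k : ℝ) + 1) / (2 * k + 1) * bhd k
      + (k : ℝ) / (2 * k + 1) * (bhg (k + 1) - bhg k) := by
    unfold bhd
    field_simp
    linear_combination h2 - (2 * (k : ℝ) + 1) * h1
  have w1 : ((k : ℝ) + 1) / (2 * k + 1) ≤ 2 / 3 := by
    rw [div_le_div_iff₀ hk1 (by norm_num)]; linarith
  have w2 : (k : ℝ) / (2 * k + 1) ≤ 1 := by
    rw [div_le_one hk1]; linarith
  rw [e]
  refine (abs_add_le _ _).trans ?_
  rw [abs_mul, abs_mul, abs_of_nonneg (show 0 ≤ ((k : ℝ) + 1) / (2 * k + 1) by positivity),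
    abs_of_nonneg (show 0 ≤ (k : ℝ) / (2 * k + 1) by positivity)]
  nlinarith [mul_le_mul_of_nonneg_right w1 (abs_nonneg (bhd k)),
    mul_le_mul_of_nonneg_right w2 (abs_nonneg (bhg (k + 1) - bhg k))]

lemma bhd_odd (k : ℕ) (hk : 2 ≤ k) :
    |bhd (2 * k + 1)| ≤ 2 / 3 * |bhd k| + |bhg (k + 1) - bhg k| := by
  have h1 := bh_log_even (k + 1) (by omega)
  have h2 := bh_log_odd k hk
  have hk2 : (2 : ℝ) ≤ k := by exact_mod_cast hk
  have hk1 : (0 : ℝ) < 2 * (k : ℝ) + 1 := by positivity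
  have e : bhd (2 * k + 1) = (k : ℝ) / (2 * k + 1) * bhd k
      + ((k : ℝ) + 1) / (2 * k + 1) * (bhg (k + 1) - bhg k) := by
    unfold bhd
    rw [show 2 * k + 1 + 1 = 2 * (k + 1) by ring]
    field_simp
    linear_combination - h2 + (2 * (k : ℝ) + 1) * h1
  have w1 : (k : ℝ) / (2 * k + 1) ≤ 2 / 3 := by
    rw [div_le_div_iff₀ hk1 (by norm_num)]; linarith
  have w2 : ((k : ℝ) + 1) / (2 * k + 1) ≤ 1 := by
    rw [div_le_one hk1]; linarith
  rw [e]
  refine (abs_add_le _ _).trans ?_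
  rw [abs_mul, abs_mul, abs_of_nonneg (show 0 ≤ ((k : ℝ) + 1) / (2 * k + 1) by positivity),
    abs_of_nonneg (show 0 ≤ (k : ℝ) / (2 * k + 1) by positivity)]
  nlinarith [mul_le_mul_of_nonneg_right w1 (abs_nonneg (bhd k)),
    mul_le_mul_of_nonneg_right w2 (abs_nonneg (bhg (k + 1) - bhg k))]

lemma bhd_rec (m : ℕ) (hm : 4 ≤ m) :
    |bhd m| ≤ 2 / 3 * |bhd (m / 2)| + |bhg (m / 2 + 1) - bhg (m / 2)| := by
  obtain ⟨k, hk | hk⟩ := Nat.even_or_odd' m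
  · have := bhd_even k (by omega)
    rw [show m / 2 = k by omega, hk]; exact this
  · have := bhd_odd k (by omega)
    rw [show m / 2 = k by omega, hk]; exact this

lemma seq_zero (x e : ℕ → ℝ) (hx : ∀ m, 0 ≤ x m) (he : Tendsto e atTop (nhds 0))
    (h : ∀ m, 4 ≤ m → x m ≤ 2 / 3 * x (m / 2) + e (m / 2)) : Tendsto x atTop (nhds 0) := by
  have key : ∀ ε : ℝ, 0 < ε → ∀ᶠ m in atTop, x m < ε := by
    intro ε hε
    obtain ⟨N, hN⟩ := eventually_atTop.1 (he.eventually (gt_mem_nhds (show 0 < ε / 6 by linarith)))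
    set M := 2 * N + 4 with hM
    set K := ∑ i ∈ Finset.range M, x i * Real.sqrt (i + 1) with hK
    have hK0 : 0 ≤ K := Finset.sum_nonneg fun i _ => mul_nonneg (hx i) (Real.sqrt_nonneg _)
    have claim : ∀ m : ℕ, x m ≤ ε / 2 + K / Real.sqrt (m + 1) := by
      intro m
      induction m using Nat.strong_induction_on with
      | _ m ih =>
        have hs : 0 < Real.sqrt ((m : ℝ) + 1) := Real.sqrt_pos.2 (by positivity)
        by_cases hm : m < M
        · have h1 : x m * Real.sqrt (m + 1) ≤ K :=
            Finset.single_le_sum (f := fun i : ℕ => x i * Real.sqrt (i + 1))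
              (fun i _ => mul_nonneg (hx i) (Real.sqrt_nonneg _)) (Finset.mem_range.2 hm)
          have h2 := (le_div_iff₀ hs).2 h1
          linarith
        · have h1 := h m (by omega)
          have h2 := ih (m / 2) (by omega)
          have h3 := hN (m / 2) (by omega)
          have hs' : 0 < Real.sqrt (((m / 2 : ℕ) : ℝ) + 1) := Real.sqrt_pos.2 (by positivity)
          have h4 : 2 / 3 * (K / Real.sqrt (((m / 2 : ℕ) : ℝ) + 1)) ≤ K / Real.sqrt (m + 1) := by
            have h5 : 2 / 3 * Real.sqrt (m + 1) ≤ Real.sqrt (((m / 2 : ℕ) : ℝ) + 1) := by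
              apply Real.le_sqrt_of_sq_le
              rw [mul_pow, Real.sq_sqrt (by positivity)]
              have : (m : ℝ) ≤ 2 * ((m / 2 : ℕ) : ℝ) + 1 := by
                exact_mod_cast (by omega : m ≤ 2 * (m / 2) + 1)
              have : (0 : ℝ) ≤ ((m / 2 : ℕ) : ℝ) := Nat.cast_nonneg _
              linarith
            rw [← mul_div_assoc, div_le_div_iff₀ hs' hs]
            nlinarith
          linarith
    have ht : Tendsto (fun m : ℕ => K / Real.sqrt ((m : ℝ) + 1)) atTop (nhds 0) := by
      refine Tendsto.const_div_atTop ?_ K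
      exact Real.tendsto_sqrt_atTop.comp
        (tendsto_atTop_add_const_right _ _ tendsto_natCast_atTop_atTop)
    filter_upwards [ht.eventually (gt_mem_nhds (show 0 < ε / 2 by linarith))] with m hm
    have := claim m
    linarith
  rw [tendsto_order]
  refine ⟨fun a ha => Eventually.of_forall fun m => lt_of_lt_of_le ha (hx m), fun a ha => key a ha⟩

lemma bhd_tendsto : Tendsto bhd atTop (nhds 0) := by
  obtain ⟨L, hL⟩ := bhg_tendsto
  have he : Tendsto (fun k => |bhg (k + 1) - bhg k|) atTop (nhds 0) := by
    have := ((hL.comp (tendsto_add_atTop_nat 1)).sub hL).abs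
    simpa using this
  have := seq_zero (fun m => |bhd m|) _ (fun m => abs_nonneg _) he bhd_rec
  exact (tendsto_zero_iff_abs_tendsto_zero _).2 this

/-- The asymptotic growth of the real Bohnenblust–Hille constants is optimal:
`C_m/C_{m−1} → 1`. -/
theorem bhConstR_ratio_tendsto_one :
    Tendsto (fun m : ℕ => bhConstR m / bhConstR (m - 1)) atTop (nhds 1) := by
  rw [← tendsto_add_atTop_iff_nat 1]
  have h := (Real.continuous_exp.tendsto 0).comp bhd_tendsto
  rw [Real.exp_zero] at h
  refine h.congr fun m => ?_
  simp only [Function.comp, bhd, Nat.add_sub_cancel]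
  rw [Real.exp_sub, Real.exp_log (bh_pos _), Real.exp_log (bh_pos _)]
end

section
/- There exists a sequence of positive real constants (C_m) with lim_{m→∞} C_m/C_{m−1} = 1 such that for every integer m ≥ 2, every positive integer N, and every continuous m-linear form U : ℂ^N × ⋯ × ℂ^N → ℂ, one has (∑_{i_1,…,i_m=1}^N |U(e_{i_1},…,e_{i_m})|^(2m/(m+1)))^((m+1)/(2m)) ≤ C_m · sup{|U(z_1,…,z_m)| : z_1,…,z_m ∈ ℂ^N, ‖z_k‖_∞ ≤ 1 for all k}, where (e_i) denotes the canonical basis of ℂ^N. -/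
open Filter

lemma bh_holder {ι : Type*} (s : Finset ι) (u v : ι → ℝ) (hu : ∀ i, 0 ≤ u i) (hv : ∀ i, 0 ≤ v i)
    {α β : ℝ} (hα : 0 < α) (hβ : 0 < β) (h : α + β = 1) :
    ∑ i ∈ s, u i ^ α * v i ^ β ≤ (∑ i ∈ s, u i) ^ α * (∑ i ∈ s, v i) ^ β := by
  have hpq : Real.HolderConjugate (1 / α) (1 / β) := by
    rw [Real.holderConjugate_iff]
    refine ⟨?_, by simpa using h⟩
    rw [lt_div_iff₀ hα]; linarith
  have := Real.inner_le_Lp_mul_Lq_of_nonneg s hpq (f := fun i => u i ^ α) (g := fun i => v i ^ β)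
    (fun i _ => Real.rpow_nonneg (hu i) _) (fun i _ => Real.rpow_nonneg (hv i) _)
  refine this.trans (le_of_eq ?_)
  simp only [one_div_one_div]
  congr 2 <;> refine Finset.sum_congr rfl fun i _ => ?_
  · rw [← Real.rpow_mul (hu i), mul_one_div_cancel hα.ne', Real.rpow_one]
  · rw [← Real.rpow_mul (hv i), mul_one_div_cancel hβ.ne', Real.rpow_one]

lemma bh_sum_insert {n : ℕ} {α M : Type*} [Fintype α] [AddCommMonoid M] (k : Fin (n + 1))
    (f : (Fin (n + 1) → α) → M) :
    ∑ x, f x = ∑ y : Fin n → α, ∑ j : α, f (k.insertNth j y) := by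
  rw [← (Fin.insertNthEquiv (fun _ => α) k).sum_comp, Fintype.sum_prod_type_right]
  rfl

/-- signs -/
def bhSgn (b : Bool) : ℂ := if b then 1 else -1

lemma bhSgn_norm (b : Bool) : ‖bhSgn b‖ = 1 := by cases b <;> simp [bhSgn]

lemma bh_two_step (x y : ℂ) : ‖x + y‖ ^ 2 + ‖-x + y‖ ^ 2 = 2 * (‖x‖ ^ 2 + ‖y‖ ^ 2) := by
  simp only [Complex.sq_norm, Complex.normSq_apply, Complex.add_re, Complex.add_im, Complex.neg_re,
    Complex.neg_im]
  ring

lemma bh_four_step (x y : ℂ) : ‖x + y‖ ^ 4 + ‖-x + y‖ ^ 4 ≤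
    2 * (‖x‖ ^ 4 + 6 * ‖x‖ ^ 2 * ‖y‖ ^ 2 + ‖y‖ ^ 4) := by
  have e : ∀ z : ℂ, ‖z‖ ^ 4 = (‖z‖ ^ 2) ^ 2 := fun z => by ring
  simp only [e, Complex.sq_norm, Complex.normSq_apply, Complex.add_re, Complex.add_im,
    Complex.neg_re, Complex.neg_im]
  nlinarith [sq_nonneg (x.re * y.im - x.im * y.re)]

lemma bh_second (n : ℕ) (a : Fin n → ℂ) :
    ∑ ε : Fin n → Bool, ‖∑ j, bhSgn (ε j) * a j‖ ^ 2 = 2 ^ n * ∑ j, ‖a j‖ ^ 2 := by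
  induction n with
  | zero => simp
  | succ n ih =>
    rw [bh_sum_insert 0]
    simp only [Fin.sum_univ_succ, Fin.insertNth_zero', Fin.cons_zero, Fin.cons_succ,
      Fintype.sum_bool, bhSgn, if_true, Bool.false_eq_true, if_false, one_mul, neg_mul]
    simp only [bh_two_step]
    have := ih (fun j => a j.succ)
    simp only [bhSgn] at this
    simp only [← Finset.mul_sum, Finset.sum_add_distrib, this]
    simp
    ring

lemma bh_fourth (n : ℕ) (a : Fin n → ℂ) :
    ∑ ε : Fin n → Bool, ‖∑ j, bhSgn (ε j) * a j‖ ^ 4 ≤ 2 ^ n * (3 * (∑ j, ‖a j‖ ^ 2) ^ 2) := by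
  induction n with
  | zero => simp
  | succ n ih =>
    rw [bh_sum_insert 0]
    have h4 := ih (fun j => a j.succ)
    have h2 := bh_second n (fun j => a j.succ)
    set S := ∑ j : Fin n, ‖a j.succ‖ ^ 2
    have key : ∑ y : Fin n → Bool, ∑ j : Bool,
        ‖∑ i, bhSgn ((Fin.insertNth 0 j y : Fin (n + 1) → Bool) i) * a i‖ ^ 4 ≤
        ∑ y : Fin n → Bool, 2 * (‖a 0‖ ^ 4 + 6 * ‖a 0‖ ^ 2 *
          ‖∑ j, bhSgn (y j) * a j.succ‖ ^ 2 + ‖∑ j, bhSgn (y j) * a j.succ‖ ^ 4) := by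
      refine Finset.sum_le_sum fun y _ => ?_
      refine le_trans (le_of_eq ?_) (bh_four_step _ _)
      simp [Fin.sum_univ_succ, bhSgn]
    refine key.trans ?_
    rw [← Finset.mul_sum, Finset.sum_add_distrib, Finset.sum_add_distrib, ← Finset.mul_sum, h2,
      Fin.sum_univ_succ]
    simp only [Finset.sum_const, Finset.card_univ, Fintype.card_fun, Fintype.card_bool,
      Fintype.card_fin, nsmul_eq_mul]
    push_cast
    have h0 : (0:ℝ) ≤ 2 ^ n * ‖a 0‖ ^ 4 := by positivity
    change _ ≤ 2 ^ (n+1) * (3 * (‖a 0‖ ^ 2 + S) ^ 2)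
    rw [pow_succ (2:ℝ) n]
    nlinarith

lemma bh_khinchine (n : ℕ) (N : ℕ) (a : Fin N → ℂ) :
    (∑ j, ‖a j‖ ^ 2) ^ ((n : ℝ) / (n + 1)) ≤ 3 ^ (1 / ((n : ℝ) + 1)) *
      ((∑ ε : Fin N → Bool, ‖∑ j, bhSgn (ε j) * a j‖ ^ (2 * (n : ℝ) / (n + 1))) / 2 ^ N) := by
  have h2 := bh_second N a
  have h4 := bh_fourth N a
  set s := ∑ j, ‖a j‖ ^ 2
  have hs : 0 ≤ s := by positivity
  set A := ∑ ε : Fin N → Bool, ‖∑ j, bhSgn (ε j) * a j‖ ^ (2 * (n : ℝ) / (n + 1)) with hA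
  have hA0 : 0 ≤ A := by positivity
  have hn1 : (0:ℝ) < n + 1 := by positivity
  have hn2 : (0:ℝ) < n + 2 := by positivity
  have hol := bh_holder Finset.univ
    (fun ε : Fin N → Bool => ‖∑ j, bhSgn (ε j) * a j‖ ^ (2 * (n : ℝ) / (n + 1)))
    (fun ε : Fin N → Bool => ‖∑ j, bhSgn (ε j) * a j‖ ^ 4) (fun _ => by positivity)
    (fun _ => by positivity) (α := (n + 1) / (n + 2)) (β := 1 / (n + 2)) (by positivity)
    (by positivity) (by field_simp; ring)
  have e1 : ∀ x : ℝ, 0 ≤ x → (x ^ (2 * (n : ℝ) / (n + 1))) ^ (((n:ℝ) + 1) / (n + 2)) *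
      (x ^ 4) ^ (1 / ((n:ℝ) + 2)) = x ^ 2 := by
    intro x hx
    rcases hx.eq_or_lt with rfl | hx
    · rw [zero_pow (by norm_num), Real.zero_rpow (x := 1 / ((n:ℝ) + 2)) (by positivity)]; simp
    rw [← Real.rpow_mul hx.le, ← Real.rpow_natCast x 4, ← Real.rpow_mul hx.le, ← Real.rpow_add hx,
      ← Real.rpow_natCast x 2]
    congr 1
    push_cast
    field_simp
    ring
  simp only [e1 _ (norm_nonneg _)] at hol
  rw [h2, ← hA] at hol
  rcases hs.eq_or_lt with h0 | hs
  · rw [← h0]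
    by_cases hn : n = 0
    · subst hn
      simp [hA]
    · rw [Real.zero_rpow (by positivity)]; positivity
  have hp : (0:ℝ) < 2 ^ N := by positivity
  have hol2 : 2 ^ N * s ≤ A ^ (((n:ℝ) + 1) / (n + 2)) * (2 ^ N * (3 * s ^ 2)) ^ (1 / ((n:ℝ) + 2)) := by
    refine hol.trans ?_
    gcongr
  have hol3 := pow_le_pow_left₀ (by positivity) hol2 (n + 2)
  rw [mul_pow _ _ (n+2), mul_pow _ _ (n+2)] at hol3
  rw [← Real.rpow_natCast (A ^ _) (n+2), ← Real.rpow_natCast ((2 ^ N * (3 * s ^ 2)) ^ _) (n+2),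
    ← Real.rpow_mul hA0, ← Real.rpow_mul (by positivity)] at hol3
  push_cast at hol3
  rw [div_mul_cancel₀ _ hn2.ne', div_mul_cancel₀ _ hn2.ne', Real.rpow_one] at hol3
  have hol4 : s ^ n ≤ 3 * (A / 2 ^ N) ^ (n + 1) := by
    have : A ^ ((n:ℝ) + 1) = A ^ (n + 1) := by rw [← Real.rpow_natCast]; push_cast; rfl
    rw [this] at hol3
    rw [div_pow, ← mul_div_assoc, le_div_iff₀ (by positivity)]
    have hq : (0:ℝ) < 2 ^ N * s ^ 2 := by positivity
    refine le_of_mul_le_mul_right ?_ hq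
    calc _ = (2 ^ N) ^ (n + 2) * s ^ (n + 2) := by ring
      _ ≤ _ := hol3
      _ = _ := by ring
  have := Real.rpow_le_rpow (by positivity) hol4 (z := 1 / ((n:ℝ) + 1)) (by positivity)
  rw [Real.mul_rpow (by positivity) (by positivity), ← Real.rpow_natCast s n,
    ← Real.rpow_natCast _ (n + 1), ← Real.rpow_mul hs.le, ← Real.rpow_mul (by positivity)] at this
  push_cast at this
  rwa [mul_one_div_cancel hn1.ne', Real.rpow_one, mul_one_div] at this

lemma bh_grid {n N : ℕ} (hn : 0 < n) (f : (Fin (n + 1) → Fin N) → ℝ) (hf : ∀ x, 0 ≤ f x) :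
    ∑ x, ∏ k, (∑ j, f (Function.update x k j)) ^ (1 / (n : ℝ)) ≤
      (∑ x, f x) ^ (((n : ℝ) + 1) / n) := by
  have hn' : (0:ℝ) < n := by exact_mod_cast hn
  have hp : Real.HolderConjugate (Fintype.card (Fin (n+1)) : ℝ) (((n : ℝ) + 1) / n) := by
    rw [Real.holderConjugate_iff]
    simp only [Fintype.card_fin]
    push_cast
    refine ⟨by linarith, by field_simp; ring⟩
  have := MeasureTheory.lintegral_prod_lintegral_pow_le
    (μ := fun _ : Fin (n + 1) => (MeasureTheory.Measure.count : MeasureTheory.Measure (Fin N))) hp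
    (f := fun x => ENNReal.ofReal (f x)) (measurable_of_finite _)
  simp only [MeasureTheory.lintegral_fintype, MeasureTheory.Measure.pi_singleton,
    MeasureTheory.Measure.count_singleton, Finset.prod_const_one, mul_one, Fintype.card_fin] at this
  push_cast at this
  rw [← ENNReal.ofReal_sum_of_nonneg (fun _ _ => hf _), ENNReal.ofReal_rpow_of_nonneg
    (Finset.sum_nonneg fun _ _ => hf _) (by positivity)] at this
  rw [← ENNReal.ofReal_le_ofReal_iff
    (Real.rpow_nonneg (Finset.sum_nonneg fun _ _ => hf _) _)]
  refine le_trans (le_of_eq ?_) this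
  have hL : ∀ (x : Fin (n+1) → Fin N) (k : Fin (n+1)), 0 ≤ ∑ j, f (Function.update x k j) :=
    fun x k => Finset.sum_nonneg fun _ _ => hf _
  rw [ENNReal.ofReal_sum_of_nonneg
    (fun x _ => Finset.prod_nonneg fun k _ => Real.rpow_nonneg (hL x k) _)]
  refine Finset.sum_congr rfl fun x _ => ?_
  rw [ENNReal.ofReal_prod_of_nonneg (fun k _ => Real.rpow_nonneg (hL x k) _)]
  refine Finset.prod_congr rfl fun k _ => ?_
  rw [← ENNReal.ofReal_rpow_of_nonneg (hL x k) (by positivity),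
    ENNReal.ofReal_sum_of_nonneg (fun _ _ => hf _)]
  congr 1
  ring

lemma bh_interp {n N : ℕ} (hn : 0 < n) (w : (Fin (n + 1) → Fin N) → ℝ) (hw : ∀ x, 0 ≤ w x)
    (T : ℝ) (hT : ∀ k : Fin (n + 1), ∑ y : Fin n → Fin N,
      (∑ j, w (k.insertNth j y)) ^ ((n : ℝ) / (n + 1)) ≤ T) :
    ∑ x, w x ^ (((n : ℝ) + 1) / (n + 2)) ≤
      ((n : ℝ) + 1) ^ (((n : ℝ) + 1) / (n * (n + 2))) *
        T ^ (((n : ℝ) + 1) ^ 2 / (n * (n + 2))) := by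
  have hn' : (0:ℝ) < n := by exact_mod_cast hn
  have hm : (0:ℝ) < n + 1 := by positivity
  have hT0 : 0 ≤ T := le_trans (Finset.sum_nonneg fun y _ => Real.rpow_nonneg
    (Finset.sum_nonneg fun j _ => hw _) _) (hT 0)
  set b : Fin (n + 1) → (Fin (n + 1) → Fin N) → ℝ :=
    fun k x => ∑ j, w (Function.update x k j) with hb
  have hb0 : ∀ k x, 0 ≤ b k x := fun k x => Finset.sum_nonneg fun _ _ => hw _
  set F : (Fin (n + 1) → Fin N) → ℝ :=
    fun x => ∑ k, (1 / ((n:ℝ) + 1)) * (w x * (b k x) ^ (-(1 / ((n:ℝ) + 1)))) with hF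
  have hterm : ∀ k x, 0 ≤ (1 / ((n:ℝ) + 1)) * (w x * (b k x) ^ (-(1 / ((n:ℝ) + 1)))) :=
    fun k x => mul_nonneg (by positivity) (mul_nonneg (hw x) (Real.rpow_nonneg (hb0 k x) _))
  have hF0 : ∀ x, 0 ≤ F x := fun x => Finset.sum_nonneg fun k _ => hterm k x
  have hpow : ∀ B : ℝ, 0 ≤ B → B * B ^ (-(1 / ((n:ℝ) + 1))) = B ^ ((n : ℝ) / (n + 1)) := by
    intro B hB
    rcases hB.eq_or_lt with rfl | hB
    · rw [zero_mul, Real.zero_rpow (by positivity)]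
    · nth_rewrite 1 [← Real.rpow_one B]
      rw [← Real.rpow_add hB]
      congr 1
      field_simp
      ring
  have hFsum : ∑ x, F x ≤ T := by
    rw [hF, Finset.sum_comm]
    have : ∀ k, ∑ x, (1 / ((n:ℝ) + 1)) * (w x * (b k x) ^ (-(1 / ((n:ℝ) + 1)))) ≤
        (1 / ((n:ℝ) + 1)) * T := by
      intro k
      rw [← Finset.mul_sum]
      refine mul_le_mul_of_nonneg_left (le_trans (le_of_eq ?_) (hT k)) (by positivity)
      rw [bh_sum_insert k]
      refine Finset.sum_congr rfl fun y _ => ?_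
      simp only [hb, Fin.update_insertNth]
      rw [← Finset.sum_mul]
      exact hpow _ (Finset.sum_nonneg fun _ _ => hw _)
    refine (Finset.sum_le_sum fun k _ => this k).trans (le_of_eq ?_)
    simp only [Finset.sum_const, Finset.card_univ, Fintype.card_fin, nsmul_eq_mul]
    push_cast
    field_simp
  set P : (Fin (n + 1) → Fin N) → ℝ :=
    fun x => ∏ k, (∑ j, F (Function.update x k j)) ^ (1 / (n : ℝ)) with hP
  have hL0 : ∀ k x, 0 ≤ ∑ j, F (Function.update x k j) :=
    fun k x => Finset.sum_nonneg fun _ _ => hF0 _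
  have hP0 : ∀ x, 0 ≤ P x := fun x => Finset.prod_nonneg fun k _ => Real.rpow_nonneg (hL0 k x) _
  have hPsum : ∑ x, P x ≤ T ^ (((n : ℝ) + 1) / n) :=
    (bh_grid hn F hF0).trans (Real.rpow_le_rpow (Finset.sum_nonneg fun _ _ => hF0 _) hFsum
      (by positivity))
  have hLine : ∀ k x, b k x ^ ((n : ℝ) / (n + 1)) * (1 / ((n:ℝ) + 1)) ≤
      ∑ j, F (Function.update x k j) := by
    intro k x
    have h1 : ∀ j, (1 / ((n:ℝ) + 1)) * (w (Function.update x k j) *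
        (b k x) ^ (-(1 / ((n:ℝ) + 1)))) ≤ F (Function.update x k j) := by
      intro j
      have h2 : b k (Function.update x k j) = b k x := by simp [hb]
      have := Finset.single_le_sum (f := fun k' => (1 / ((n:ℝ) + 1)) * (w (Function.update x k j) *
        (b k' (Function.update x k j)) ^ (-(1 / ((n:ℝ) + 1))))) (s := Finset.univ)
        (fun k' _ => hterm k' _) (Finset.mem_univ k)
      rw [← h2]
      exact this
    refine le_trans (le_of_eq ?_) (Finset.sum_le_sum fun j _ => h1 j)
    rw [← Finset.mul_sum, ← Finset.sum_mul, ← hpow _ (hb0 k x)]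
    simp only [hb]
    ring
  have hpt : ∀ x, w x ^ (n + 1) ≤ ((n:ℝ) + 1) ^ (((n:ℝ) + 1) / n) * (F x ^ (n + 1) * P x) := by
    intro x
    rcases (hw x).eq_or_lt with h0 | hwx
    · rw [← h0, zero_pow (by omega)]
      have := hF0 x
      have := hP0 x
      positivity
    have hbpos : ∀ k, 0 < b k x := by
      intro k
      refine lt_of_lt_of_le hwx ?_
      have := Finset.single_le_sum (f := fun j => w (Function.update x k j)) (s := Finset.univ)
        (fun j _ => hw _) (Finset.mem_univ (x k))
      simpa [hb] using this
    set X : Fin (n + 1) → ℝ := fun k => b k x ^ (1 / ((n:ℝ) + 1)) with hX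
    have hX0 : ∀ k, 0 < X k := fun k => Real.rpow_pos_of_pos (hbpos k) _
    have hPge : (∏ k, X k) * ((1 / ((n:ℝ) + 1)) ^ (1 / (n:ℝ))) ^ (n + 1) ≤ P x := by
      have : ((1 / ((n:ℝ) + 1)) ^ (1 / (n:ℝ))) ^ (n + 1) =
          ∏ k : Fin (n + 1), (1 / ((n:ℝ) + 1)) ^ (1 / (n:ℝ)) := by simp
      rw [this, ← Finset.prod_mul_distrib]
      refine Finset.prod_le_prod (fun k _ => mul_nonneg (hX0 k).le (by positivity)) fun k _ => ?_
      refine le_trans (le_of_eq ?_) (Real.rpow_le_rpow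
        (mul_nonneg (Real.rpow_nonneg (hb0 k x) _) (by positivity)) (hLine k x)
        (by positivity))
      rw [Real.mul_rpow (Real.rpow_nonneg (hb0 k x) _) (by positivity), ← Real.rpow_mul (hb0 k x)]
      congr 1
      simp only [hX]
      congr 1
      field_simp
    have hFge : w x ^ (n + 1) * (∏ k, X k)⁻¹ ≤ F x ^ (n + 1) := by
      have am := Real.geom_mean_le_arith_mean_weighted (Finset.univ : Finset (Fin (n + 1)))
        (fun _ => 1 / ((n:ℝ) + 1)) (fun k => w x * (b k x) ^ (-(1 / ((n:ℝ) + 1))))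
        (fun _ _ => by positivity) (by simp; field_simp)
        (fun k _ => mul_nonneg (hw x) (Real.rpow_nonneg (hb0 k x) _))
      refine le_trans (le_of_eq ?_) (pow_le_pow_left₀ (Finset.prod_nonneg fun k _ =>
        Real.rpow_nonneg (mul_nonneg (hw x) (Real.rpow_nonneg (hb0 k x) _)) _) am (n + 1))
      rw [← Finset.prod_pow]
      have : ∀ k, ((w x * b k x ^ (-(1 / ((n:ℝ) + 1)))) ^ (1 / ((n:ℝ) + 1))) ^ (n + 1) =
          w x * (X k)⁻¹ := by
        intro k
        have h1 : 0 ≤ w x * b k x ^ (-(1 / ((n:ℝ) + 1))) :=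
          mul_nonneg (hw x) (Real.rpow_nonneg (hb0 k x) _)
        rw [← Real.rpow_natCast, ← Real.rpow_mul h1]
        push_cast
        rw [one_div_mul_cancel hm.ne', Real.rpow_one, Real.rpow_neg (hb0 k x)]
      simp only [this, Finset.prod_mul_distrib, Finset.prod_inv_distrib]
      simp
    have hXp : 0 < ∏ k, X k := Finset.prod_pos fun k _ => hX0 k
    have hc : ((n:ℝ) + 1) ^ (((n:ℝ) + 1) / n) * ((1 / ((n:ℝ) + 1)) ^ (1 / (n:ℝ))) ^ (n + 1) = 1 := by
      rw [← Real.rpow_natCast _ (n+1), ← Real.rpow_mul (by positivity), one_div,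
        Real.inv_rpow (by positivity)]
      push_cast
      rw [show 1 / (n:ℝ) * (n + 1) = (n + 1) / n by ring]
      exact mul_inv_cancel₀ (by positivity)
    calc w x ^ (n + 1) = (((n:ℝ) + 1) ^ (((n:ℝ) + 1) / n) *
          ((1 / ((n:ℝ) + 1)) ^ (1 / (n:ℝ))) ^ (n + 1)) * (w x ^ (n + 1) *
            ((∏ k, X k)⁻¹ * (∏ k, X k))) := by
          rw [hc, inv_mul_cancel₀ hXp.ne']; ring
      _ = ((n:ℝ) + 1) ^ (((n:ℝ) + 1) / n) * ((w x ^ (n + 1) * (∏ k, X k)⁻¹) *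
          ((∏ k, X k) * ((1 / ((n:ℝ) + 1)) ^ (1 / (n:ℝ))) ^ (n + 1))) := by ring
      _ ≤ _ := by
          have := hF0 x
          refine mul_le_mul_of_nonneg_left ?_ (by positivity)
          exact mul_le_mul hFge hPge (by positivity) (by positivity)
  have hpt2 : ∀ x, w x ^ (((n : ℝ) + 1) / (n + 2)) ≤
      ((n : ℝ) + 1) ^ (((n : ℝ) + 1) / (n * (n + 2))) *
        (F x ^ (((n : ℝ) + 1) / (n + 2)) * P x ^ (1 / ((n:ℝ) + 2))) := by
    intro x
    have h1 := Real.rpow_le_rpow (pow_nonneg (hw x) _) (hpt x) (z := 1 / ((n:ℝ) + 2))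
      (by positivity)
    have h2 := hF0 x
    have h3 := hP0 x
    rw [Real.mul_rpow (by positivity) (by positivity), Real.mul_rpow (by positivity) (by positivity),
      ← Real.rpow_mul (by positivity), ← Real.rpow_natCast, ← Real.rpow_natCast,
      ← Real.rpow_mul (hw x), ← Real.rpow_mul h2] at h1
    push_cast at h1
    rw [mul_one_div, div_mul_div_comm, mul_one] at h1
    exact h1
  refine (Finset.sum_le_sum fun x _ => hpt2 x).trans ?_
  rw [← Finset.mul_sum]
  refine mul_le_mul_of_nonneg_left ?_ (by positivity)
  refine (bh_holder Finset.univ F P hF0 hP0 (α := ((n : ℝ) + 1) / (n + 2)) (β := 1 / ((n:ℝ) + 2))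
    (by positivity) (by positivity) (by field_simp; ring)).trans ?_
  have hFs0 : 0 ≤ ∑ x, F x := Finset.sum_nonneg fun x _ => hF0 x
  have hPs0 : 0 ≤ ∑ x, P x := Finset.sum_nonneg fun x _ => hP0 x
  calc _ ≤ T ^ (((n : ℝ) + 1) / (n + 2)) * (T ^ (((n : ℝ) + 1) / n)) ^ (1 / ((n:ℝ) + 2)) := by
        gcongr
    _ = _ := by
        rw [← Real.rpow_mul hT0, ← Real.rpow_add_of_nonneg hT0 (by positivity) (by positivity)]
        congr 1
        field_simp

/-- the constants -/
noncomputable def bhC : ℕ → ℝ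
  | 0 => 1
  | (n + 1) => (3 * ((n : ℝ) + 1)) ^ (1 / (2 * (n : ℝ))) * bhC n

lemma bhC_pos (n : ℕ) : 0 < bhC n := by
  induction n with
  | zero => simp [bhC]
  | succ n ih => rw [bhC]; positivity

lemma bhC_tendsto : Tendsto (fun m : ℕ => bhC m / bhC (m - 1)) atTop (nhds 1) := by
  have h := tendsto_rpow_div_mul_add 1 (2 / 3) (-2) (by norm_num)
  have h2 : Tendsto (fun m : ℕ => 3 * (m : ℝ)) atTop atTop :=
    tendsto_natCast_atTop_atTop.const_mul_atTop (by norm_num)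
  refine (h.comp h2).congr' ?_
  filter_upwards [eventually_ge_atTop 1] with m hm
  obtain ⟨n, rfl⟩ : ∃ n, m = n + 1 := ⟨m - 1, by omega⟩
  simp only [Function.comp, Nat.add_sub_cancel]
  rw [bhC, mul_div_assoc, div_self (bhC_pos n).ne', mul_one]
  push_cast
  congr 2
  ring

lemma bh_tensor (n : ℕ) : ∀ (N : ℕ) (a : (Fin (n + 1) → Fin N) → ℂ) (B : ℝ), 0 ≤ B →
    (∀ z : Fin (n + 1) → Fin N → ℂ, (∀ k j, ‖z k j‖ ≤ 1) → ‖∑ x, a x * ∏ k, z k (x k)‖ ≤ B) →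
    ∑ x, ‖a x‖ ^ (2 * ((n : ℝ) + 1) / (n + 2)) ≤ (bhC (n + 1) * B) ^ (2 * ((n : ℝ) + 1) / (n + 2)) := by
  induction n with
  | zero =>
    intro N a B hB h
    have hC : bhC (0 + 1) = 1 := by simp [bhC]
    rw [hC]
    norm_num
    have := h (fun _ j => (starRingEnd ℂ) (a fun _ => j) / ‖a fun _ => j‖) (by
      intro k j
      rw [norm_div, RCLike.norm_conj, Complex.norm_real, norm_norm]
      exact div_self_le_one _)
    have hc : ∀ x : Fin 1 → Fin N, (fun _ => x 0) = x := fun x => by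
      funext i; rw [Subsingleton.elim i 0]
    have hs : ∑ x : Fin 1 → Fin N, a x * ∏ k : Fin 1,
        (starRingEnd ℂ) (a fun _ => x k) / ‖a fun _ => x k‖ = ((∑ x, ‖a x‖ : ℝ) : ℂ) := by
      push_cast
      refine Finset.sum_congr rfl fun x _ => ?_
      rw [Fin.prod_univ_one, hc x, ← mul_div_assoc, Complex.mul_conj, Complex.normSq_eq_norm_sq]
      by_cases h0 : ‖a x‖ = 0
      · simp [h0]
      · push_cast
        have : (‖a x‖ : ℂ) ≠ 0 := by exact_mod_cast h0
        field_simp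
    change ‖∑ x : Fin 1 → Fin N, _‖ ≤ B at this
    rw [hs, Complex.norm_real, Real.norm_eq_abs, abs_of_nonneg (by positivity)] at this
    exact this
  | succ n ih =>
    intro N a B hB h
    have hCB : 0 ≤ bhC (n + 1) * B := mul_nonneg (bhC_pos _).le hB
    set D := bhC (n + 1) * B with hD
    have key := bh_interp (n := n + 1) (N := N) (by omega) (fun x => ‖a x‖ ^ 2)
      (fun _ => by positivity)
      (3 ^ (1 / (((n + 1 : ℕ) : ℝ) + 1)) * D ^ (2 * ((n : ℝ) + 1) / (n + 2))) (by
      intro k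
      have step : ∀ ε : Fin N → Bool, ∑ y : Fin (n + 1) → Fin N,
          ‖∑ j, bhSgn (ε j) * a (k.insertNth j y)‖ ^ (2 * ((n : ℝ) + 1) / (n + 2)) ≤
          D ^ (2 * ((n : ℝ) + 1) / (n + 2)) := by
        intro ε
        refine ih N (fun y => ∑ j, bhSgn (ε j) * a (k.insertNth j y)) B hB ?_
        intro z hz
        have := h (k.insertNth (fun j => bhSgn (ε j)) z) (by
          intro l j
          refine Fin.succAboveCases k ?_ (fun i => ?_) l
          · simp [bhSgn_norm]
          · simpa using hz i j)
        refine le_trans (le_of_eq ?_) this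
        congr 1
        rw [bh_sum_insert k]
        refine Finset.sum_congr rfl fun y _ => ?_
        rw [Finset.sum_mul]
        refine Finset.sum_congr rfl fun j _ => ?_
        rw [Fin.prod_univ_succAbove _ k]
        simp only [Fin.insertNth_apply_same, Fin.insertNth_apply_succAbove]
        ring
      have kh := fun y : Fin (n + 1) → Fin N =>
        bh_khinchine (n + 1) N (fun j => a (k.insertNth j y))
      refine (Finset.sum_le_sum fun y _ => kh y).trans ?_
      rw [← Finset.mul_sum, ← Finset.sum_div, Finset.sum_comm]
      refine mul_le_mul_of_nonneg_left ?_ (by positivity)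
      rw [div_le_iff₀ (by positivity)]
      refine (Finset.sum_le_sum fun ε _ => ?_).trans
        (le_of_eq (a := ∑ ε : Fin N → Bool, D ^ (2 * ((n : ℝ) + 1) / (n + 2))) ?_)
      · refine le_trans (le_of_eq ?_) (step ε)
        refine Finset.sum_congr rfl fun y _ => ?_
        congr 1
        push_cast
        ring
      · simp [mul_comm])
    refine le_trans (le_of_eq ?_) (key.trans (le_of_eq ?_))
    · refine Finset.sum_congr rfl fun x _ => ?_
      rw [← Real.rpow_natCast _ 2, ← Real.rpow_mul (norm_nonneg _)]
      congr 1
      push_cast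
      ring
    · rw [bhC, mul_assoc, ← hD]
      clear_value D
      push_cast
      have h1 : (0:ℝ) < n + 1 := by positivity
      have h2 : (0:ℝ) < n + 1 + 1 := by positivity
      have h3 : (0:ℝ) < n + 1 + 2 := by positivity
      have h4 : (0:ℝ) < n + 2 := by positivity
      rw [Real.mul_rpow (by positivity) (by positivity), Real.mul_rpow (by positivity) hCB,
        ← Real.rpow_mul (by positivity), ← Real.rpow_mul hCB, ← Real.rpow_mul (by positivity),
        Real.mul_rpow (by positivity) (by positivity)]
      have e1 : 1 / ((n:ℝ) + 1 + 1) * (((n:ℝ) + 1 + 1) ^ 2 / ((n + 1) * (n + 1 + 2))) =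
        ((n:ℝ) + 1 + 1) / ((n + 1) * (n + 1 + 2)) := by field_simp
      have e2 : 2 * ((n:ℝ) + 1) / (n + 2) * (((n:ℝ) + 1 + 1) ^ 2 / ((n + 1) * (n + 1 + 2))) =
        2 * ((n:ℝ) + 1 + 1) / (n + 1 + 2) := by field_simp; ring
      have e3 : 1 / (2 * ((n:ℝ) + 1)) * (2 * ((n:ℝ) + 1 + 1) / (n + 1 + 2)) =
        ((n:ℝ) + 1 + 1) / ((n + 1) * (n + 1 + 2)) := by field_simp
      rw [e1, e2, e3]
      ring

/-- There is a family of positive constants `(C_m)` with `C_m/C_{m−1} → 1` satisfying the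
Bohnenblust–Hille inequality: for every `m ≥ 2`, every `N ≥ 1` and every continuous
`m`-linear form `U : ℂ^N × ⋯ × ℂ^N → ℂ` (where `ℂ^N` carries the sup norm),
`(∑_{i₁,…,i_m} |U(e_{i₁},…,e_{i_m})|^(2m/(m+1)))^((m+1)/(2m)) ≤ C_m · sup_{‖z_k‖∞ ≤ 1} |U(z)|`. -/
theorem bohnenblust_hille_optimal_asymptotics :
    ∃ C : ℕ → ℝ, (∀ m, 0 < C m) ∧
      Tendsto (fun m : ℕ => C m / C (m - 1)) atTop (nhds 1) ∧
      ∀ m : ℕ, 2 ≤ m → ∀ N : ℕ, 0 < N →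
        ∀ U : ContinuousMultilinearMap ℂ (fun _ : Fin m => (Fin N → ℂ)) ℂ,
          (∑ i : Fin m → Fin N,
              ‖U (fun k => Pi.single (i k) 1)‖ ^ (2 * (m : ℝ) / ((m : ℝ) + 1))) ^
              (((m : ℝ) + 1) / (2 * (m : ℝ))) ≤
            C m * ⨆ z : {z : Fin m → (Fin N → ℂ) // ∀ k, ‖z k‖ ≤ 1}, ‖U z.1‖ := by
  refine ⟨bhC, bhC_pos, bhC_tendsto, ?_⟩
  intro m hm N _ U
  obtain ⟨n, rfl⟩ : ∃ n, m = n + 1 := ⟨m - 1, by omega⟩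
  have hbdd : BddAbove (Set.range
      fun z : {z : Fin (n + 1) → (Fin N → ℂ) // ∀ k, ‖z k‖ ≤ 1} => ‖U z.1‖) := by
    refine ⟨‖U‖, ?_⟩
    rintro _ ⟨z, rfl⟩
    refine (U.le_opNorm z.1).trans ?_
    refine mul_le_of_le_one_right (norm_nonneg _) ?_
    exact Finset.prod_le_one (fun _ _ => norm_nonneg _) fun k _ => z.2 k
  set B := ⨆ z : {z : Fin (n + 1) → (Fin N → ℂ) // ∀ k, ‖z k‖ ≤ 1}, ‖U z.1‖ with hB
  have hB0 : 0 ≤ B := Real.iSup_nonneg fun _ => norm_nonneg _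
  have hexp : ∀ z : Fin (n + 1) → Fin N → ℂ,
      U z = ∑ x : Fin (n + 1) → Fin N, U (fun k => Pi.single (x k) 1) * ∏ k, z k (x k) := by
    intro z
    have hz : z = fun k => ∑ j, z k j • (Pi.single j 1 : Fin N → ℂ) := by
      funext k
      exact pi_eq_sum_univ' (z k)
    conv_lhs => rw [hz]
    rw [U.map_sum]
    refine Finset.sum_congr rfl fun x _ => ?_
    rw [U.map_smul_univ, smul_eq_mul, mul_comm]
  have main := bh_tensor n N (fun x => U (fun k => Pi.single (x k) 1)) B hB0 (by
    intro z hz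
    rw [← hexp z]
    exact le_ciSup hbdd ⟨z, fun k => (pi_norm_le_iff_of_nonneg zero_le_one).2 (hz k)⟩)
  have hCB : 0 ≤ bhC (n + 1) * B := mul_nonneg (bhC_pos _).le hB0
  push_cast
  rw [show (n:ℝ) + 1 + 1 = n + 2 by ring]
  refine (Real.rpow_le_rpow (by positivity) main (by positivity)).trans (le_of_eq ?_)
  rw [← Real.rpow_mul hCB]
  have : 2 * ((n:ℝ) + 1) / (n + 2) * ((n + 2) / (2 * (n + 1))) = 1 := by
    have h1 : (n:ℝ) + 1 ≠ 0 := by positivity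
    have h2 : (n:ℝ) + 2 ≠ 0 := by positivity
    field_simp
  rw [this, Real.rpow_one]
end
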